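/- arXiv:2402.08213 — 2 statements merged into one kernel-verified Lean document; each statement's English description precedes it below -/
import Mathlib

section
/- Let a > 0 and for each k ∈ ℕ set β_k := √((k+1/2)² + a). Then there exists a constant C > 0 such that for every ρ > 0 and every τ ∈ [−1,1] one has |Σ_{k=0}^∞ exp(−iπβ_k/2) · J_{β_k}(ρ) · ((2k+1)/(4π)) · P_k(τ)| ≤ C · ρ^{1/2}. (This is the uniform boundedness of the kernel function K(ρ,ϑ,ϑ') = ρ^{−1/2} Σ_k i^{−β_k} J_{β_k}(ρ) Z_ϑ^{(k)}(ϑ') with τ = ϑ·ϑ', Lemma 2.1 of the paper in the case a > 0.) -/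
/-- The Bessel function of the first kind `J_ν(ρ)`, defined by its power series. -/
noncomputable def besselJ (ν ρ : ℝ) : ℝ :=
  ∑' m : ℕ, (-1 : ℝ) ^ m * (ρ / 2) ^ (2 * (m : ℝ) + ν) /
    ((m.factorial : ℝ) * Real.Gamma ((m : ℝ) + ν + 1))

/-- The degree-`k` Legendre polynomial. -/
noncomputable def legendreP (k : ℕ) (x : ℝ) : ℝ :=
  (1 / 2 ^ k : ℝ) * ∑ j ∈ Finset.range (k + 1),
    ((k.choose j : ℝ)) ^ 2 * (x - 1) ^ (k - j) * (x + 1) ^ j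

/-- `β_k = √((k+1/2)² + a)`. -/
noncomputable def betaCoef (a : ℝ) (k : ℕ) : ℝ :=
  Real.sqrt (((k : ℝ) + 1 / 2) ^ 2 + a)

open Real MeasureTheory Filter Topology Set

lemma integrable_exp_neg_exp_add_mul {r : ℝ} (hr : 0 < r) :
    Integrable (fun t : ℝ => rexp (-rexp t + r * t)) := by
  have h := integrableOn_image_iff_integrableOn_abs_deriv_smul (s := Set.univ) (f := rexp)
    (f' := rexp) MeasurableSet.univ (fun x _ => (Real.hasDerivAt_exp x).hasDerivWithinAt)
    Real.exp_injective.injOn (fun x => rexp (-x) * x ^ (r - 1))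
  rw [Set.image_univ, Real.range_exp] at h
  have h2 := h.1 (Real.GammaIntegral_convergent hr)
  rw [integrableOn_univ] at h2
  refine h2.congr (Eventually.of_forall fun t => ?_)
  simp only [abs_exp, smul_eq_mul]
  rw [← Real.exp_mul, ← Real.exp_add, ← Real.exp_add]
  congr 1; ring

lemma integral_exp_neg_exp_add_mul {r : ℝ} (hr : 0 < r) :
    ∫ t : ℝ, rexp (-rexp t + r * t) = Gamma r := by
  have h := integral_image_eq_integral_abs_deriv_smul (s := Set.univ) (f := rexp)
    (f' := rexp) MeasurableSet.univ (fun x _ => (Real.hasDerivAt_exp x).hasDerivWithinAt)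
    Real.exp_injective.injOn (fun x => rexp (-x) * x ^ (r - 1))
  rw [Set.image_univ, Real.range_exp] at h
  rw [Real.Gamma_eq_integral hr, h, Measure.restrict_univ]
  refine integral_congr_ae (Eventually.of_forall fun t => ?_)
  simp only [abs_exp, smul_eq_mul]
  rw [← Real.exp_mul, ← Real.exp_add, ← Real.exp_add]
  congr 1; ring

lemma integrableOn_exp_neg_exp_add_mul {r : ℝ} (hr : r ≤ 1) (x : ℝ) :
    IntegrableOn (fun t : ℝ => rexp (-rexp t + r * t)) (Ioi x) := by
  have h := ((integrable_exp_neg_exp_add_mul one_pos).integrableOn (s := Ioi x)).const_mul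
    (rexp ((r - 1) * x))
  refine h.mono' (by fun_prop) ((ae_restrict_mem measurableSet_Ioi).mono fun t ht => ?_)
  rw [Real.norm_eq_abs, abs_exp, ← Real.exp_add, Real.exp_le_exp]
  have : x < t := ht
  nlinarith

/-- The circular part of the Hankel contour integral, in logarithmic coordinates. -/
noncomputable def hankelCircle (s x : ℝ) : ℂ :=
  ∫ θ in -π..π, Complex.exp (Complex.exp (x + θ * Complex.I) + (1 - s) * (x + θ * Complex.I))

/-- The ray part of the Hankel contour integral, in logarithmic coordinates. -/
noncomputable def hankelRay (s x : ℝ) : ℝ :=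
  ∫ t in Ioi x, rexp (-rexp t + (1 - s) * t)

lemma hankelCircle_sub_mul_succ (s x : ℝ) :
    hankelCircle s x - s * hankelCircle (s + 1) x
      = ((-2 * sin (π * s) * rexp (-rexp x - s * x) : ℝ) : ℂ) := by
  have hd : ∀ θ : ℝ, HasDerivAt
      (fun θ : ℝ => Complex.exp (Complex.exp (x + θ * Complex.I) - s * (x + θ * Complex.I)))
      (Complex.I * (Complex.exp (Complex.exp (x + θ * Complex.I) + (1 - s) * (x + θ * Complex.I))
        - s * Complex.exp (Complex.exp (x + θ * Complex.I)
            + (1 - (s + 1 : ℝ)) * (x + θ * Complex.I)))) θ := by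
    intro θ
    have h1 : HasDerivAt (fun θ : ℝ => (x : ℂ) + θ * Complex.I) Complex.I θ := by
      simpa using ((Complex.ofRealCLM.hasDerivAt (x := θ)).mul_const Complex.I).const_add (x : ℂ)
    have h2 := (h1.cexp.sub (h1.const_mul (s : ℂ))).cexp
    refine HasDerivAt.congr_deriv h2 ?_
    have e1 : Complex.exp (Complex.exp (x + θ * Complex.I) + (1 - s) * (x + θ * Complex.I))
      = Complex.exp (Complex.exp (x + θ * Complex.I) - s * (x + θ * Complex.I)) *
        Complex.exp (x + θ * Complex.I) := by
      rw [← Complex.exp_add]; ring_nf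
    have e2 : Complex.exp (Complex.exp (x + θ * Complex.I)
            + (1 - (s + 1 : ℝ)) * (x + θ * Complex.I))
      = Complex.exp (Complex.exp (x + θ * Complex.I) - s * (x + θ * Complex.I)) := by
      push_cast; ring_nf
    rw [e1, e2]; simp only [Pi.sub_apply]; ring
  have hI := intervalIntegral.integral_eq_sub_of_hasDerivAt (a := -π) (b := π)
    (fun θ _ => hd θ) (Continuous.intervalIntegrable (by fun_prop) _ _)
  rw [intervalIntegral.integral_const_mul, intervalIntegral.integral_sub
    (Continuous.intervalIntegrable (by fun_prop) _ _)
    (Continuous.intervalIntegrable (by fun_prop) _ _), intervalIntegral.integral_const_mul] at hI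
  change Complex.I * (hankelCircle s x - s * hankelCircle (s + 1) x) = _ at hI
  have e3 : Complex.exp (x + (π : ℝ) * Complex.I) = -(rexp x : ℝ) := by
    rw [Complex.exp_add, Complex.exp_pi_mul_I]; push_cast; ring
  have e4 : Complex.exp (x + (-π : ℝ) * Complex.I) = -(rexp x : ℝ) := by
    push_cast
    rw [Complex.exp_add, neg_mul, Complex.exp_neg, Complex.exp_pi_mul_I]; norm_num
  rw [e3, e4] at hI
  have e5 : ∀ y : ℝ, Complex.exp (-(rexp x : ℝ) - s * (x + y * Complex.I))
      = (rexp (-rexp x - s * x) : ℝ) * Complex.exp ((-(s * y) : ℝ) * Complex.I) := by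
    intro y
    push_cast
    rw [← Complex.exp_add]; ring_nf
  rw [e5, e5, Complex.exp_ofReal_mul_I, Complex.exp_ofReal_mul_I] at hI
  have h6 : -(s * -π) = π * s := by ring
  have h7 : -(s * π) = -(π * s) := by ring
  rw [h6, h7, Real.sin_neg, Real.cos_neg] at hI
  have := mul_left_cancel₀ Complex.I_ne_zero (hI.trans (b := _) (c := Complex.I *
    ((-2 * sin (π * s) * rexp (-rexp x - s * x) : ℝ) : ℂ)) (by push_cast; ring))
  exact this

lemma hankelRay_add_mul_succ {s : ℝ} (hs : 0 < s) (x : ℝ) :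
    hankelRay s x + s * hankelRay (s + 1) x = rexp (-rexp x - s * x) := by
  have hd : ∀ t : ℝ, HasDerivAt (fun t => rexp (-rexp t - s * t))
      (-(rexp (-rexp t + (1 - s) * t) + s * rexp (-rexp t + (1 - (s + 1)) * t))) t := by
    intro t
    have h2 := ((Real.hasDerivAt_exp t).neg.sub ((hasDerivAt_id t).const_mul s)).exp
    refine HasDerivAt.congr_deriv h2 ?_
    have e1 : rexp (-rexp t + (1 - s) * t) = rexp (-rexp t - s * t) * rexp t := by
      rw [← Real.exp_add]; ring_nf
    have e2 : rexp (-rexp t + (1 - (s + 1)) * t) = rexp (-rexp t - s * t) := by ring_nf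
    rw [e1, e2]; simp only [Pi.sub_apply, Pi.neg_apply, id]; ring
  have i1 := integrableOn_exp_neg_exp_add_mul (r := 1 - s) (by linarith) x
  have i2 := (integrableOn_exp_neg_exp_add_mul (r := 1 - (s + 1)) (by linarith) x).const_mul s
  have ht : Tendsto (fun t => rexp (-rexp t - s * t)) atTop (𝓝 0) := by
    refine Real.tendsto_exp_comp_nhds_zero.2 ?_
    refine tendsto_atBot_mono (fun t => (by have := (Real.exp_pos t).le; linarith :
      -rexp t - s * t ≤ -(s * t))) ?_
    exact tendsto_neg_atTop_atBot.comp (tendsto_id.const_mul_atTop hs)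
  have := integral_Ioi_of_hasDerivAt_of_tendsto (a := x) (hd x).continuousAt.continuousWithinAt
    (fun t _ => hd t) (i1.add i2).neg ht
  rw [integral_neg, integral_add i1 i2, integral_const_mul] at this
  unfold hankelRay
  linarith

lemma hankelCircle_one (x : ℝ) : hankelCircle 1 x = 2 * π := by
  have h := DiffContOnCl.circleAverage (f := Complex.exp) (c := 0) (R := rexp x)
    Complex.differentiable_exp.diffContOnCl
  rw [Real.circleAverage_def, Complex.exp_zero] at h
  have hper := (periodic_circleMap 0 (rexp x)).comp Complex.exp
  have h2 := hper.intervalIntegral_add_eq 0 (-π)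
  have hπ : (π : ℂ) ≠ 0 := by exact_mod_cast Real.pi_ne_zero
  rw [zero_add, show -π + 2 * π = π by ring] at h2
  simp only [Function.comp_apply] at h2
  rw [h2, Complex.real_smul] at h
  have e : ∀ θ : ℝ, Complex.exp (circleMap 0 (rexp x) θ)
      = Complex.exp (Complex.exp (x + θ * Complex.I)
        + (1 - (1 : ℝ)) * (x + θ * Complex.I)) := by
    intro θ
    rw [Complex.exp_add (x : ℂ)]
    simp [circleMap]
  simp only [e] at h
  change _ * hankelCircle 1 x = 1 at h
  push_cast at h
  field_simp at h
  exact h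

lemma hankelCircle_of_lt_one {s : ℝ} (hs : s < 1) (x : ℝ) :
    hankelCircle s x = ((2 * sin (π * s) * ∫ t in Iic x, rexp (-rexp t + (1 - s) * t) : ℝ) : ℂ) := by
  have hrect : ∀ y : ℝ, hankelCircle s x - hankelCircle s y
      = ((2 * sin (π * s) * ∫ t in y..x, rexp (-rexp t + (1 - s) * t) : ℝ) : ℂ) := by
    intro y
    have h := Complex.integral_boundary_rect_eq_zero_of_differentiableOn
      (fun ζ : ℂ => Complex.exp (Complex.exp ζ + (1 - s) * ζ)) (⟨y, -π⟩ : ℂ) ⟨x, π⟩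
      (Differentiable.differentiableOn (by fun_prop))
    simp only [smul_eq_mul] at h
    have e5 : ∀ t c : ℝ, Complex.exp (t + c * Complex.I) = -(rexp t : ℝ) →
        Complex.exp (Complex.exp (t + c * Complex.I) + (1 - s) * (t + c * Complex.I))
        = Complex.exp (((1 - s) * c : ℝ) * Complex.I) * (rexp (-rexp t + (1 - s) * t) : ℝ) := by
      intro t c h
      rw [h]
      push_cast
      rw [← Complex.exp_add]; ring_nf
    have e3 : ∀ t : ℝ, Complex.exp (t + (π : ℝ) * Complex.I) = -(rexp t : ℝ) := by
      intro t
      rw [Complex.exp_add, Complex.exp_pi_mul_I]; push_cast; ring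
    have e4 : ∀ t : ℝ, Complex.exp (t + (-π : ℝ) * Complex.I) = -(rexp t : ℝ) := by
      intro t
      push_cast
      rw [Complex.exp_add, neg_mul, Complex.exp_neg, Complex.exp_pi_mul_I]; norm_num
    have e6 : ∀ t : ℝ, _ := fun t => e5 t π (e3 t)
    have e7 : ∀ t : ℝ, _ := fun t => e5 t (-π) (e4 t)
    simp_rw [e6, e7, intervalIntegral.integral_const_mul, intervalIntegral.integral_ofReal,
      Complex.exp_ofReal_mul_I] at h
    change _ + Complex.I * hankelCircle s x - Complex.I * hankelCircle s y = 0 at h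
    have h6 : (1 - s) * π = π - π * s := by ring
    have h7 : (1 - s) * -π = -(π - π * s) := by ring
    rw [h6, h7, Real.sin_neg, Real.cos_neg, Real.sin_pi_sub] at h
    refine mul_left_cancel₀ Complex.I_ne_zero ?_
    push_cast at h ⊢
    linear_combination h
  have hint : IntegrableOn (fun t : ℝ => rexp (-rexp t + (1 - s) * t)) (Iic x) :=
    (integrable_exp_neg_exp_add_mul (by linarith)).integrableOn
  have hlim := (intervalIntegral_tendsto_integral_Iic x hint tendsto_id).const_mul (2 * sin (π * s))
  have hlim2 : Tendsto (fun y => hankelCircle s y) atBot (𝓝 0) := by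
    rw [tendsto_zero_iff_norm_tendsto_zero]
    refine squeeze_zero' (g := fun y => rexp (1 + (1 - s) * y) * (2 * π))
      (Eventually.of_forall fun _ => norm_nonneg _) ?_ ?_
    · filter_upwards [eventually_le_atBot 0] with y hy
      have := intervalIntegral.norm_integral_le_of_norm_le_const (a := -π) (b := π)
        (C := rexp (1 + (1 - s) * y))
        (f := fun θ : ℝ => Complex.exp (Complex.exp (y + θ * Complex.I) + (1 - s) * (y + θ * Complex.I)))
        (fun θ _ => by
          rw [Complex.norm_exp, Real.exp_le_exp]
          have h1 : (Complex.exp (y + θ * Complex.I)).re ≤ 1 := by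
            refine (Complex.re_le_norm _).trans ?_
            rw [Complex.norm_exp]; simpa using hy
          simp at h1 ⊢
          linarith)
      refine this.trans (le_of_eq ?_)
      rw [abs_of_pos (by linarith [Real.pi_pos])]; ring
    · have : Tendsto (fun y => 1 + (1 - s) * y) atBot atBot :=
        tendsto_atBot_add_const_left _ _ (tendsto_id.const_mul_atBot (by linarith))
      simpa using (Real.tendsto_exp_atBot.comp this).mul_const (2 * π)
  have h1 : Tendsto (fun y => hankelCircle s x - hankelCircle s y) atBot (𝓝 (hankelCircle s x - 0)) :=
    tendsto_const_nhds.sub hlim2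
  rw [sub_zero] at h1
  refine tendsto_nhds_unique h1 ?_
  simp_rw [hrect]
  exact (Complex.continuous_ofReal.tendsto _).comp hlim

/-- Hankel's integral representation of the reciprocal Gamma function. -/
lemma inv_Gamma_eq_hankel {s : ℝ} (hs : 0 < s) (x : ℝ) :
    (((Gamma s)⁻¹ : ℝ) : ℂ) = (2 * π)⁻¹ * hankelCircle s x + (sin (π * s) / π * hankelRay s x : ℝ) := by
  obtain ⟨n, hn⟩ : ∃ n : ℕ, s ≤ n + 1 := ⟨⌈s⌉₊, (Nat.le_ceil s).trans (by linarith)⟩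
  induction n generalizing s with
  | zero =>
    have hπ : (π : ℂ) ≠ 0 := by exact_mod_cast Real.pi_ne_zero
    rcases (show s ≤ 1 by simpa using hn).lt_or_eq with h1 | rfl
    · rw [hankelCircle_of_lt_one h1]
      have hint := integrable_exp_neg_exp_add_mul (r := 1 - s) (by linarith)
      have hsum := intervalIntegral.integral_Iic_add_Ioi (b := x) hint.integrableOn hint.integrableOn
      rw [integral_exp_neg_exp_add_mul (by linarith)] at hsum
      have hg := Real.Gamma_mul_Gamma_one_sub s
      have hsin : 0 < sin (π * s) := Real.sin_pos_of_pos_of_lt_pi (by positivity)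
        (by nlinarith [Real.pi_pos])
      have hΓ := Real.Gamma_pos_of_pos hs
      have : (Gamma s)⁻¹ = sin (π * s) / π * Gamma (1 - s) := by
        field_simp
        rw [eq_div_iff hsin.ne'] at hg
        linarith
      rw [this, ← hsum]
      change _ = _ + ((_ * hankelRay s x : ℝ) : ℂ)
      unfold hankelRay
      push_cast
      field_simp
    · rw [hankelCircle_one]
      simp
      field_simp
  | succ n ih =>
    rcases le_or_gt s (n + 1) with h | h
    · exact ih hs h
    · have hn0 : (0 : ℝ) ≤ n := n.cast_nonneg
      have h0 : 0 < s - 1 := by linarith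
      have h1 := ih h0 (by push_cast at hn; linarith)
      have h2 := hankelCircle_sub_mul_succ (s - 1) x
      have h3 := hankelRay_add_mul_succ h0 x
      rw [sub_add_cancel] at h2 h3
      have h4 : Gamma s = (s - 1) * Gamma (s - 1) := by
        have := Real.Gamma_add_one h0.ne'
        rwa [sub_add_cancel] at this
      have h5 : sin (π * s) = - sin (π * (s - 1)) := by
        rw [← Real.sin_add_pi]; ring_nf
      have h6 : hankelCircle (s - 1) x = (s - 1 : ℝ) * hankelCircle s x +
          ((-2 * sin (π * (s - 1)) * rexp (-rexp x - (s - 1) * x) : ℝ) : ℂ) := by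
        rw [← h2]; ring
      rw [h6, ← h3] at h1
      have hπ : (π : ℂ) ≠ 0 := by exact_mod_cast Real.pi_ne_zero
      have h7 : ((s - 1 : ℝ) : ℂ) ≠ 0 := by exact_mod_cast h0.ne'
      refine mul_left_cancel₀ h7 ?_
      have h8 : ((s - 1 : ℝ) : ℂ) * ((Gamma s)⁻¹ : ℝ) = ((Gamma (s - 1))⁻¹ : ℝ) := by
        rw [h4, ← Complex.ofReal_mul]; congr 1; field_simp
      rw [h8, h1, h5]
      push_cast
      field_simp
      ring

lemma rpow_mul_exp_neg_le_Gamma {x ν : ℝ} (hx : 0 < x) (hν : 0 ≤ ν) :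
    x ^ ν * rexp (-x) ≤ Gamma (ν + 1) := by
  have hc := Real.GammaIntegral_convergent (s := ν + 1) (by linarith)
  rw [Real.Gamma_eq_integral (by linarith), ← integral_exp_neg_Ioi, ← integral_const_mul]
  have hsub : Ioi x ⊆ Ioi (0 : ℝ) := Ioi_subset_Ioi hx.le
  calc ∫ t in Ioi x, x ^ ν * rexp (-t) ≤ ∫ t in Ioi x, rexp (-t) * t ^ (ν + 1 - 1) := by
        refine setIntegral_mono_on ((integrableOn_exp_neg_Ioi x).const_mul _) (hc.mono_set hsub)
          measurableSet_Ioi fun t ht => ?_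
        rw [mul_comm, add_sub_cancel_right]
        gcongr
        exact le_of_lt ht
    _ ≤ _ := setIntegral_mono_set hc
        ((ae_restrict_mem measurableSet_Ioi).mono fun t ht => by
          have : (0 : ℝ) < t := ht
          simp only [Pi.zero_apply]; positivity) hsub.eventuallyLE

/-- The `m`-th term of the power series defining `besselJ ν ρ`. -/
noncomputable def besselTerm (ν ρ : ℝ) (m : ℕ) : ℝ :=
  (-1 : ℝ) ^ m * (ρ / 2) ^ (2 * (m : ℝ) + ν) / ((m.factorial : ℝ) * Gamma ((m : ℝ) + ν + 1))

lemma abs_besselTerm_le {ν ρ x : ℝ} (hν : 0 ≤ ν) (hρ : 0 < ρ) (hx : 0 < x) (m : ℕ) :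
    |besselTerm ν ρ m| ≤ rexp x * (ρ / (2 * x)) ^ ν * ((ρ ^ 2 / (4 * x)) ^ m / m.factorial) := by
  have hΓ := rpow_mul_exp_neg_le_Gamma hx (show 0 ≤ (m : ℝ) + ν by positivity)
  have hf : (0 : ℝ) < m.factorial := by exact_mod_cast m.factorial_pos
  have hl : 0 < x ^ ((m : ℝ) + ν) * rexp (-x) := by positivity
  rw [besselTerm, abs_div, abs_mul, abs_pow, abs_neg, abs_one, one_pow, one_mul,
    abs_of_pos (show 0 < (ρ / 2) ^ (2 * (m : ℝ) + ν) by positivity),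
    abs_of_pos (mul_pos hf (hl.trans_le hΓ))]
  calc (ρ / 2) ^ (2 * (m : ℝ) + ν) / (m.factorial * Gamma (m + ν + 1))
      ≤ (ρ / 2) ^ (2 * (m : ℝ) + ν) / (m.factorial * (x ^ ((m : ℝ) + ν) * rexp (-x))) := by gcongr
    _ = _ := by
      rw [Real.exp_neg, Real.rpow_add (by positivity), Real.rpow_add hx, Real.rpow_natCast,
        show (2 * (m : ℝ)) = ((2 * m : ℕ) : ℝ) by push_cast; ring, Real.rpow_natCast,
        show ρ / (2 * x) = (ρ / 2) / x by field_simp, Real.div_rpow (by positivity) hx.le,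
        show ρ ^ 2 / (4 * x) = (ρ / 2) ^ 2 / x by field_simp; norm_num, div_pow ((ρ / 2) ^ 2), ← pow_mul]
      field_simp

lemma summable_besselTerm {ν ρ : ℝ} (hν : 0 ≤ ν) (hρ : 0 < ρ) : Summable (besselTerm ν ρ) :=
  .of_norm_bounded ((Real.summable_pow_div_factorial _).mul_left _)
    (abs_besselTerm_le hν hρ one_pos)

lemma abs_besselJ_le {ν ρ x : ℝ} (hν : 0 ≤ ν) (hρ : 0 < ρ) (hx : 0 < x) :
    |besselJ ν ρ| ≤ rexp (x + ρ ^ 2 / (4 * x)) * (ρ / (2 * x)) ^ ν := by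
  have hs : HasSum (fun m : ℕ => (ρ ^ 2 / (4 * x)) ^ m / m.factorial) (rexp (ρ ^ 2 / (4 * x))) := by
    rw [Real.exp_eq_exp_ℝ]; exact NormedSpace.expSeries_div_hasSum_exp _
  have := tsum_of_norm_bounded (f := besselTerm ν ρ) (hs.mul_left (rexp x * (ρ / (2 * x)) ^ ν))
    (fun m => abs_besselTerm_le hν hρ hx m)
  rw [Real.exp_add]
  refine this.trans (le_of_eq ?_)
  ring

/-- Schläfli's integral representation of the Bessel function. -/
lemma besselJ_eq_schlafli {ν ρ : ℝ} (hν : 0 < ν) (hρ : 0 < ρ) :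
    (besselJ ν ρ : ℂ) =
      (2 * π)⁻¹ * (∫ θ in -π..π, Complex.exp ((ρ * sin θ - ν * θ : ℝ) * Complex.I))
      - (sin (π * ν) / π * ∫ t in Ioi (0 : ℝ), rexp (-ρ * sinh t - ν * t) : ℝ) := by
  set R := ρ / 2 with hR
  have hR0 : 0 < R := by positivity
  have hRx : rexp (log R) = R := Real.exp_log hR0
  have hpow : ∀ r : ℝ, R ^ r = rexp (r * log R) := fun r => by
    rw [Real.rpow_def_of_pos hR0, mul_comm]
  have hexpC : ∀ z : ℂ, HasSum (fun m : ℕ => z ^ m / m.factorial) (Complex.exp z) := fun z => by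
    rw [Complex.exp_eq_exp_ℂ]; exact NormedSpace.expSeries_div_hasSum_exp _
  have hexpR : ∀ z : ℝ, HasSum (fun m : ℕ => z ^ m / m.factorial) (rexp z) := fun z => by
    rw [Real.exp_eq_exp_ℝ]; exact NormedSpace.expSeries_div_hasSum_exp _
  -- the circle part
  have hcirc : HasSum (fun m : ℕ => ((-1 : ℝ) ^ m * R ^ (2 * (m : ℝ) + ν) / m.factorial : ℝ)
      * hankelCircle (m + ν + 1) (log R))
      (∫ θ in -π..π, Complex.exp ((ρ * sin θ - ν * θ : ℝ) * Complex.I)) := by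
    have hterm : ∀ (m : ℕ) (θ : ℝ),
        ((-1 : ℝ) ^ m * R ^ (2 * (m : ℝ) + ν) / m.factorial : ℝ) *
          Complex.exp (Complex.exp ((log R : ℝ) + θ * Complex.I) + (1 - ((m : ℝ) + ν + 1 : ℝ)) *
            ((log R : ℝ) + θ * Complex.I))
        = (-(R * Complex.exp (-(θ * Complex.I)))) ^ m / m.factorial *
          Complex.exp (R * Complex.exp (θ * Complex.I) - ν * θ * Complex.I) := by
      intro m θ
      rw [Complex.exp_add ((log R : ℝ) : ℂ), ← Complex.ofReal_exp, hRx, hpow,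
        neg_pow ((R : ℂ) * _), mul_pow (R : ℂ), ← Complex.exp_nat_mul]
      have : (R : ℂ) ^ m = Complex.exp (m * log R) := by
        rw [Complex.exp_nat_mul, ← Complex.ofReal_exp, hRx]
      rw [this]
      push_cast
      have e : Complex.exp ((2 * m + ν) * (log R : ℝ)) * Complex.exp (R * Complex.exp (θ * Complex.I)
            + (1 - (m + ν + 1)) * ((log R : ℝ) + θ * Complex.I))
          = Complex.exp (m * (log R : ℝ)) * Complex.exp (m * -(θ * Complex.I)) *
            Complex.exp (R * Complex.exp (θ * Complex.I) - ν * θ * Complex.I) := by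
        rw [← Complex.exp_add, ← Complex.exp_add, ← Complex.exp_add]
        congr 1; ring
      linear_combination ((-1) ^ m / (m.factorial : ℂ)) * e
    have := intervalIntegral.hasSum_integral_of_dominated_convergence (a := -π) (b := π) (μ := volume)
      (F := fun (m : ℕ) (θ : ℝ) => (-(R * Complex.exp (-(θ * Complex.I)))) ^ m / m.factorial *
          Complex.exp (R * Complex.exp (θ * Complex.I) - ν * θ * Complex.I))
      (f := fun θ : ℝ => Complex.exp ((ρ * sin θ - ν * θ : ℝ) * Complex.I))
      (fun m _ => R ^ m / m.factorial * rexp R)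
      (fun m => Continuous.aestronglyMeasurable (by fun_prop))
      (fun m => Eventually.of_forall fun θ _ => by
        rw [norm_mul, norm_div, norm_pow, norm_neg, norm_mul, ← neg_mul, ← Complex.ofReal_neg,
          Complex.norm_exp_ofReal_mul_I, mul_one, Complex.norm_real, Real.norm_of_nonneg hR0.le,
          Complex.norm_natCast, Complex.norm_exp]
        gcongr
        rw [Complex.sub_re, Complex.re_ofReal_mul, Complex.exp_ofReal_mul_I_re]
        simp
        nlinarith [Real.cos_le_one θ])
      (Eventually.of_forall fun θ _ => ((hexpR R).summable.mul_right _))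
      (by simp)
      (Eventually.of_forall fun θ _ => by
        have h := (hexpC (-(R * Complex.exp (-(θ * Complex.I))))).mul_right
          (Complex.exp (R * Complex.exp (θ * Complex.I) - ν * θ * Complex.I))
        rw [← Complex.exp_add] at h
        refine Eq.mpr (congrArg (fun z => HasSum _ (Complex.exp z)) ?_) h
        rw [← neg_mul (θ : ℂ), ← Complex.ofReal_neg, Complex.exp_ofReal_mul_I (-θ), Complex.exp_ofReal_mul_I θ,
          Real.sin_neg, Real.cos_neg, hR]
        push_cast
        ring)
    refine Eq.mpr (congrArg (fun f => HasSum f _) (funext fun m => ?_)) this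
    unfold hankelCircle
    rw [← intervalIntegral.integral_const_mul]
    exact intervalIntegral.integral_congr fun θ _ => hterm m θ
  -- the ray part
  have hray : HasSum (fun m : ℕ => ((-1 : ℝ) ^ m * R ^ (2 * (m : ℝ) + ν) / m.factorial : ℝ)
      * (sin (π * (m + ν + 1)) / π * hankelRay (m + ν + 1) (log R)))
      (- (sin (π * ν) / π * ∫ t in Ioi (0 : ℝ), rexp (-ρ * sinh t - ν * t))) := by
    have hshift : ∀ m : ℕ, R ^ (2 * (m : ℝ) + ν) / m.factorial * hankelRay (m + ν + 1) (log R)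
        = ∫ t in Ioi (0 : ℝ), (R * rexp (-t)) ^ m / m.factorial * rexp (-R * rexp t - ν * t) := by
      intro m
      unfold hankelRay
      have := (measurePreserving_add_right volume (log R)).setIntegral_preimage_emb
        (measurableEmbedding_addRight (log R))
        (fun t => rexp (-rexp t + (1 - ((m : ℝ) + ν + 1)) * t)) (Ioi (log R))
      rw [Set.preimage_add_const_Ioi, sub_self] at this
      rw [← this, ← integral_const_mul]
      refine integral_congr_ae (Eventually.of_forall fun t => ?_)
      simp only
      rw [Real.exp_add t, hRx, hpow, mul_pow, ← Real.exp_nat_mul]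
      have : R ^ m = rexp (m * log R) := by
        rw [Real.exp_nat_mul, hRx]
      rw [this]
      have e : rexp ((2 * m + ν) * log R) * rexp (-(rexp t * R) + (1 - (m + ν + 1)) * (t + log R))
          = rexp (m * log R) * rexp (m * -t) * rexp (-R * rexp t - ν * t) := by
        rw [← Real.exp_add, ← Real.exp_add, ← Real.exp_add]
        congr 1; ring
      linear_combination (1 / (m.factorial : ℝ)) * e
    have hdom : IntegrableOn (fun t : ℝ => rexp (-ν * t)) (Ioi 0) :=
      integrableOn_exp_mul_Ioi (by linarith) 0
    have hb : ∀ (m : ℕ) (t : ℝ), t ∈ Ioi (0 : ℝ) →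
        ‖(R * rexp (-t)) ^ m / m.factorial * rexp (-R * rexp t - ν * t)‖
          ≤ R ^ m / m.factorial * rexp (-ν * t) := by
      intro m t ht
      have ht : 0 < t := ht
      rw [Real.norm_of_nonneg (by positivity)]
      have : R * rexp (-t) ≤ R := by
        have : rexp (-t) ≤ 1 := Real.exp_le_one_iff.2 (by linarith)
        nlinarith
      gcongr
      have := Real.exp_pos t
      nlinarith
    have hi : ∀ m : ℕ, IntegrableOn (fun t =>
        (R * rexp (-t)) ^ m / m.factorial * rexp (-R * rexp t - ν * t)) (Ioi 0) := fun m =>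
      (hdom.const_mul (R ^ m / m.factorial)).mono' (by fun_prop)
        ((ae_restrict_mem measurableSet_Ioi).mono fun t ht => hb m t ht)
    have hS := hasSum_integral_of_summable_integral_norm (μ := volume.restrict (Ioi (0 : ℝ))) hi
      (.of_nonneg_of_le (fun m => integral_nonneg fun t => norm_nonneg _) (fun m =>
        (setIntegral_mono_on (hi m).norm (hdom.const_mul (R ^ m / m.factorial))
          measurableSet_Ioi (hb m)).trans_eq (integral_const_mul _ _))
        ((hexpR R).summable.mul_right _))
    have hsum : ∀ t : ℝ, ∑' m : ℕ, (R * rexp (-t)) ^ m / m.factorial * rexp (-R * rexp t - ν * t)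
        = rexp (-ρ * sinh t - ν * t) := by
      intro t
      rw [((hexpR (R * rexp (-t))).mul_right _).tsum_eq, ← Real.exp_add, Real.sinh_eq]
      congr 1
      rw [hR]; ring
    simp_rw [hsum] at hS
    rw [← neg_mul]
    refine Eq.mpr (congrArg (fun f => HasSum f _) (funext fun m => ?_))
      (hS.mul_left (-(sin (π * ν) / π)))
    rw [← hshift]
    have : sin (π * (m + ν + 1)) = -((-1) ^ m * sin (π * ν)) := by
      rw [← Real.sin_add_nat_mul_pi, ← Real.sin_add_pi]; ring_nf
    rw [this]
    have h1 : ((-1 : ℝ) ^ m) ^ 2 = 1 := by rw [← pow_mul, mul_comm, pow_mul]; norm_num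
    linear_combination (-(R ^ (2 * (m : ℝ) + ν) / m.factorial *
      (sin (π * ν) / π * hankelRay (m + ν + 1) (log R)))) * h1
  have h1 := (hcirc.mul_left ((2 * π : ℂ)⁻¹)).add ((Complex.hasSum_ofReal).2 hray)
  have h2 : HasSum (fun m : ℕ => ((besselTerm ν ρ m : ℝ) : ℂ)) (besselJ ν ρ : ℝ) :=
    Complex.hasSum_ofReal.2 (summable_besselTerm hν.le hρ).hasSum
  rw [Complex.ofReal_neg, ← sub_eq_add_neg] at h1
  push_cast at h1 ⊢
  refine h2.unique (Eq.mpr (congrArg (fun f => HasSum f _) (funext fun m => ?_)) h1)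
  have hH := inv_Gamma_eq_hankel (s := m + ν + 1) (by positivity) (log R)
  rw [besselTerm, ← div_div, div_eq_mul_inv, Complex.ofReal_mul, hH, ← hR]
  push_cast
  ring

/-- The integrand of Laplace's first integral for the Legendre polynomials. -/
noncomputable def laplaceBase (x φ : ℝ) : ℂ := x + Complex.I * √(1 - x ^ 2) * cos φ

@[fun_prop]
lemma continuous_laplaceBase (x : ℝ) : Continuous (laplaceBase x) := by
  unfold laplaceBase; fun_prop

lemma norm_laplaceBase_le {x : ℝ} (hx : x ∈ Icc (-1 : ℝ) 1) (φ : ℝ) : ‖laplaceBase x φ‖ ≤ 1 := by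
  have h1 : 0 ≤ 1 - x ^ 2 := by nlinarith [hx.1, hx.2]
  have e : laplaceBase x φ = (x : ℂ) + ((√(1 - x ^ 2) * cos φ : ℝ) : ℂ) * Complex.I := by
    unfold laplaceBase; push_cast; ring
  rw [e, Complex.norm_add_mul_I, Real.sqrt_le_one, mul_pow, Real.sq_sqrt h1]
  nlinarith [Real.cos_sq_le_one φ]

lemma integral_exp_int_mul_I (n : ℤ) :
    ∫ φ in (0 : ℝ)..2 * π, Complex.exp (n * φ * Complex.I) = if n = 0 then (2 * π : ℂ) else 0 := by
  split_ifs with h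
  · simp [h]
  · have hn : (n : ℂ) * Complex.I ≠ 0 := by simpa using h
    have : ∀ φ : ℝ, Complex.exp (n * φ * Complex.I) = Complex.exp (n * Complex.I * φ) := by
      intro φ; ring_nf
    simp_rw [this]
    rw [integral_exp_mul_complex hn]
    have : (n : ℂ) * Complex.I * (2 * π : ℝ) = n * (2 * π * Complex.I) := by push_cast; ring
    rw [this, Complex.exp_int_mul_two_pi_mul_I]
    simp

/-- Laplace's first integral for the Legendre polynomials. -/
lemma legendreP_eq_integral {x : ℝ} (hx : x ∈ Icc (-1 : ℝ) 1) (k : ℕ) :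
    (legendreP k x : ℂ) = (2 * π : ℂ)⁻¹ * ∫ φ in (0 : ℝ)..2 * π, laplaceBase x φ ^ k := by
  set u : ℂ := Complex.I * √(1 - x) with hu
  set v : ℂ := ((√(1 + x) : ℝ) : ℂ) with hv
  have hu2 : u ^ 2 = x - 1 := by
    rw [hu, mul_pow, Complex.I_sq, ← Complex.ofReal_pow, Real.sq_sqrt (by linarith [hx.2])]
    push_cast; ring
  have hv2 : v ^ 2 = x + 1 := by
    rw [hv, ← Complex.ofReal_pow, Real.sq_sqrt (by linarith [hx.1])]
    push_cast; ring
  have huv : u * v = Complex.I * √(1 - x ^ 2) := by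
    rw [hu, hv, mul_assoc, ← Complex.ofReal_mul, ← Real.sqrt_mul (by linarith [hx.2])]
    ring_nf
  have hw : ∀ φ : ℝ, laplaceBase x φ ^ k = (1 / 2) ^ k * ∑ j ∈ Finset.range (k + 1),
      ∑ l ∈ Finset.range (k + 1), (v ^ j * u ^ (k - j) * k.choose j) *
        (v ^ l * u ^ (k - l) * k.choose l) * Complex.exp (((l : ℤ) - (j : ℤ) : ℤ) * φ * Complex.I) := by
    intro φ
    have h1 : laplaceBase x φ = (1 / 2) * ((v + u * Complex.exp (φ * Complex.I)) *
        (v + u * Complex.exp (-(φ * Complex.I)))) := by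
      have hc : Complex.exp (φ * Complex.I) + Complex.exp (-(φ * Complex.I)) = 2 * (cos φ : ℝ) := by
        rw [Complex.ofReal_cos, Complex.two_cos, neg_mul]
      have hm : Complex.exp (φ * Complex.I) * Complex.exp (-(φ * Complex.I)) = 1 := by
        rw [← Complex.exp_add]; simp
      unfold laplaceBase
      rw [← huv]
      linear_combination (-1 / 2 : ℂ) * hu2 - (1 / 2) * hv2 - (1 / 2) * u * v * hc
        - (1 / 2) * u ^ 2 * hm
    rw [h1, mul_pow, mul_pow, add_pow, add_pow, Finset.sum_mul_sum]
    congr 1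
    refine Finset.sum_congr rfl fun j hj => Finset.sum_congr rfl fun l hl => ?_
    have hj' : j ≤ k := by simpa [Nat.lt_succ_iff] using hj
    have hl' : l ≤ k := by simpa [Nat.lt_succ_iff] using hl
    rw [mul_pow u, mul_pow u, ← Complex.exp_nat_mul, ← Complex.exp_nat_mul]
    have : Complex.exp ((k - j : ℕ) * (φ * Complex.I)) * Complex.exp ((k - l : ℕ) * -(φ * Complex.I))
        = Complex.exp (((l : ℤ) - (j : ℤ) : ℤ) * φ * Complex.I) := by
      rw [← Complex.exp_add]
      push_cast [hj', hl']
      congr 1; ring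
    rw [← this]; ring
  simp_rw [hw]
  rw [intervalIntegral.integral_const_mul, intervalIntegral.integral_finsetSum
    (fun j _ => Continuous.intervalIntegrable (by fun_prop) _ _)]
  have hin : ∀ j ∈ Finset.range (k + 1), ∫ φ in (0 : ℝ)..2 * π, ∑ l ∈ Finset.range (k + 1),
      (v ^ j * u ^ (k - j) * k.choose j) * (v ^ l * u ^ (k - l) * k.choose l) *
        Complex.exp (((l : ℤ) - (j : ℤ) : ℤ) * φ * Complex.I)
      = 2 * π * ((k.choose j : ℂ) ^ 2 * (x - 1) ^ (k - j) * (x + 1) ^ j) := by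
    intro j hj
    rw [intervalIntegral.integral_finsetSum
      (fun l _ => Continuous.intervalIntegrable (by fun_prop) _ _)]
    simp_rw [intervalIntegral.integral_const_mul, integral_exp_int_mul_I]
    rw [Finset.sum_eq_single_of_mem j hj]
    · rw [← hu2, ← hv2]
      simp only [sub_self, if_true]
      ring
    · intro l _ hl
      rw [if_neg, mul_zero]
      rw [sub_eq_zero]; exact_mod_cast hl
  rw [Finset.sum_congr rfl hin, ← Finset.mul_sum, legendreP]
  have hπ : (π : ℂ) ≠ 0 := by exact_mod_cast Real.pi_ne_zero
  push_cast
  rw [one_div_pow]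
  field_simp

lemma abs_legendreP_le_one {x : ℝ} (hx : x ∈ Icc (-1 : ℝ) 1) (k : ℕ) : |legendreP k x| ≤ 1 := by
  rw [← Real.norm_eq_abs, ← Complex.norm_real, legendreP_eq_integral hx]
  have := intervalIntegral.norm_integral_le_of_norm_le_const (a := 0) (b := 2 * π) (C := 1)
    (f := fun φ => laplaceBase x φ ^ k)
    (fun φ _ => by rw [norm_pow]; exact pow_le_one₀ (norm_nonneg _) (norm_laplaceBase_le hx φ))
  rw [sub_zero, abs_of_pos (by positivity), one_mul] at this
  have h2 : ‖(2 * π : ℂ)⁻¹‖ = (2 * π)⁻¹ := by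
    rw [norm_inv, norm_mul, Complex.norm_real, Real.norm_of_nonneg Real.pi_pos.le]; simp
  rw [norm_mul, h2]
  calc _ ≤ (2 * π)⁻¹ * (2 * π) := by gcongr
    _ = 1 := inv_mul_cancel₀ (by positivity)

/-- Bonnet's recursion. -/
lemma legendreP_recursion {x : ℝ} (hx : x ∈ Icc (-1 : ℝ) 1) (k : ℕ) :
    (2 * k + 1) * x * legendreP k x = (k + 1) * legendreP (k + 1) x + k * legendreP (k - 1) x := by
  have hs2 : (Complex.I * √(1 - x ^ 2)) ^ 2 = (x : ℂ) ^ 2 - 1 := by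
    rw [mul_pow, Complex.I_sq, ← Complex.ofReal_pow, Real.sq_sqrt (by nlinarith [hx.1, hx.2])]
    push_cast; ring
  have hd : ∀ φ : ℝ, HasDerivAt
      (fun φ : ℝ => Complex.I * √(1 - x ^ 2) * sin φ * laplaceBase x φ ^ k)
      ((k + 1) * laplaceBase x φ ^ (k + 1) - (2 * k + 1) * x * laplaceBase x φ ^ k
        + k * laplaceBase x φ ^ (k - 1)) φ := by
    intro φ
    have hsin : HasDerivAt (fun φ : ℝ => (sin φ : ℂ)) (cos φ : ℝ) φ := (Real.hasDerivAt_sin φ).ofReal_comp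
    have hcos : HasDerivAt (fun φ : ℝ => (cos φ : ℂ)) (-sin φ : ℝ) φ := (Real.hasDerivAt_cos φ).ofReal_comp
    have hb : HasDerivAt (laplaceBase x) (Complex.I * √(1 - x ^ 2) * (-sin φ : ℝ)) φ :=
      (hcos.const_mul _).const_add _
    refine ((hsin.const_mul (Complex.I * √(1 - x ^ 2))).mul (hb.pow k)).congr_deriv ?_
    have hsc : (sin φ : ℂ) ^ 2 = 1 - (cos φ : ℂ) ^ 2 := by
      have := Real.sin_sq_add_cos_sq φ
      have h : ((sin φ : ℂ)) ^ 2 + (cos φ : ℂ) ^ 2 = 1 := by exact_mod_cast this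
      linear_combination h
    have hw : Complex.I * √(1 - x ^ 2) * cos φ = laplaceBase x φ - x := by
      unfold laplaceBase; ring
    have hp : (k : ℂ) * laplaceBase x φ ^ (k - 1) * laplaceBase x φ = k * laplaceBase x φ ^ k := by
      cases k with
      | zero => simp
      | succ n => simp [pow_succ]; ring
    simp only [Pi.pow_apply]
    set w := laplaceBase x φ
    set s := Complex.I * (√(1 - x ^ 2) : ℂ)
    push_cast at hw hsc ⊢
    rw [pow_succ]
    linear_combination (w ^ k + k * w ^ (k - 1) * (s * Complex.cos φ + w - x)) * hw
      - s ^ 2 * k * w ^ (k - 1) * hsc - k * w ^ (k - 1) * hs2 + (w - 2 * x) * hp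
  have hI := intervalIntegral.integral_eq_sub_of_hasDerivAt (a := 0) (b := 2 * π)
    (fun φ _ => hd φ) (Continuous.intervalIntegrable (by fun_prop) _ _)
  rw [intervalIntegral.integral_add (Continuous.intervalIntegrable (by fun_prop) _ _)
    (Continuous.intervalIntegrable (by fun_prop) _ _), intervalIntegral.integral_sub
    (Continuous.intervalIntegrable (by fun_prop) _ _)
    (Continuous.intervalIntegrable (by fun_prop) _ _)] at hI
  simp_rw [intervalIntegral.integral_const_mul] at hI
  simp only [Real.sin_two_pi, Real.sin_zero, Complex.ofReal_zero, mul_zero, zero_mul, sub_zero] at hI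
  have : ((((2 * k + 1) * x * legendreP k x : ℝ)) : ℂ)
      = ((((k + 1) * legendreP (k + 1) x + k * legendreP (k - 1) x : ℝ)) : ℂ) := by
    push_cast
    rw [legendreP_eq_integral hx, legendreP_eq_integral hx, legendreP_eq_integral hx]
    linear_combination (-(2 * π : ℂ)⁻¹) * hI
  exact_mod_cast this

lemma legendreP_zero (x : ℝ) : legendreP 0 x = 1 := by simp [legendreP]

/-- The pairs `(k, m)` with `k + 2 m = n`. -/
def degreePairs (n : ℕ) : Finset (ℕ × ℕ) :=
  (Finset.range (n + 1) ×ˢ Finset.range (n + 1)).filter fun p => p.1 + 2 * p.2 = n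

lemma mem_degreePairs {n : ℕ} {p : ℕ × ℕ} : p ∈ degreePairs n ↔ p.1 + 2 * p.2 = n := by
  simp only [degreePairs, Finset.mem_filter, Finset.mem_product, Finset.mem_range]
  omega

/-- The coefficients of the double power series of a plane wave. -/
noncomputable def planeWaveCoeff (x : ℝ) (p : ℕ × ℕ) : ℝ :=
  (2 * p.1 + 1) * legendreP p.1 x / (p.2.factorial * Gamma (p.2 + p.1 + 3 / 2))

lemma sum_planeWaveCoeff_succ {x : ℝ} (hx : x ∈ Icc (-1 : ℝ) 1) (n : ℕ) :
    (n + 1) * ∑ p ∈ degreePairs (n + 1), planeWaveCoeff x p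
      = 2 * x * ∑ p ∈ degreePairs n, planeWaveCoeff x p := by
  let u : ℕ × ℕ → ℝ := fun p =>
    2 * p.1 * legendreP p.1 x / (p.2.factorial * Gamma (p.2 + p.1 + 1 / 2))
  let w : ℕ × ℕ → ℝ := fun p =>
    2 * (p.1 + 1) * p.2 * legendreP p.1 x / (p.2.factorial * Gamma (p.2 + p.1 + 3 / 2))
  let w' : ℕ × ℕ → ℝ := fun p =>
    2 * p.1 * legendreP (p.1 - 1) x / (p.2.factorial * Gamma (p.2 + p.1 + 3 / 2))
  have hΓ : ∀ k m : ℕ, Gamma ((m : ℝ) + k + 3 / 2) = (m + k + 1 / 2) * Gamma (m + k + 1 / 2) := by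
    intro k m
    rw [← Real.Gamma_add_one (by positivity)]; congr 1; ring
  have hpos : ∀ k m : ℕ, Gamma ((m : ℝ) + k + 1 / 2) ≠ 0 := fun k m =>
    (Real.Gamma_pos_of_pos (by positivity)).ne'
  have hu : ∑ p ∈ degreePairs n, u (p.1 + 1, p.2) = ∑ p ∈ degreePairs (n + 1), u p := by
    refine Finset.sum_bij_ne_zero (fun p _ _ => (p.1 + 1, p.2)) ?_ ?_ ?_ ?_
    · intro p hp _
      rw [mem_degreePairs] at hp ⊢; simp only; omega
    · rintro ⟨k, m⟩ _ _ ⟨k', m'⟩ _ _ h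
      simpa using h
    · rintro ⟨k, m⟩ hp h0
      rw [mem_degreePairs] at hp
      obtain _ | k := k
      · simp [u] at h0
      · exact ⟨(k, m), by rw [mem_degreePairs]; simp only at hp ⊢; omega, h0, rfl⟩
    · intro _ _ _; rfl
  have hw' : ∀ k m : ℕ, w' (k + 1, m) = w (k, m + 1) := by
    intro k m
    simp only [w', w, Nat.add_sub_cancel, Nat.factorial_succ]
    push_cast
    rw [show (m : ℝ) + 1 + k + 3 / 2 = m + (k + 1) + 3 / 2 by ring]
    have : (m : ℝ) + 1 ≠ 0 := by positivity
    field_simp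
  have hw : ∑ p ∈ degreePairs n, w' p = ∑ p ∈ degreePairs (n + 1), w p := by
    refine Finset.sum_bij_ne_zero (fun p _ _ => (p.1 - 1, p.2 + 1)) ?_ ?_ ?_ ?_
    · rintro ⟨k, m⟩ hp h0
      rw [mem_degreePairs] at hp ⊢
      obtain _ | k := k
      · simp [w'] at h0
      · simp only at hp ⊢; omega
    · rintro ⟨k, m⟩ _ h1 ⟨k', m'⟩ _ h2 h
      obtain _ | k := k
      · simp [w'] at h1
      obtain _ | k' := k'
      · simp [w'] at h2
      simpa using h
    · rintro ⟨k, m⟩ hp h0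
      rw [mem_degreePairs] at hp
      obtain _ | m := m
      · simp [w] at h0
      · exact ⟨(k + 1, m), by rw [mem_degreePairs]; simp only at hp ⊢; omega, by rwa [hw'], rfl⟩
    · rintro ⟨k, m⟩ hp h0
      obtain _ | k := k
      · simp [w'] at h0
      · exact hw' k m
  have h1 : ∀ p : ℕ × ℕ, 2 * x * planeWaveCoeff x p = u (p.1 + 1, p.2) + w' p := by
    rintro ⟨k, m⟩
    simp only [planeWaveCoeff, u, w']
    push_cast
    rw [show (m : ℝ) + (k + 1) + 1 / 2 = m + k + 3 / 2 by ring, ← add_div]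
    linear_combination 2 / (m.factorial * Gamma (m + k + 3 / 2)) * legendreP_recursion hx k
  have h2 : ∀ p : ℕ × ℕ, (p.1 + 2 * p.2) * planeWaveCoeff x p = u p + w p := by
    rintro ⟨k, m⟩
    simp only [planeWaveCoeff, u, w]
    rw [hΓ]
    have := hpos k m
    have : (m : ℝ) + k + 1 / 2 ≠ 0 := by positivity
    field_simp
    ring
  rw [Finset.mul_sum, Finset.mul_sum, Finset.sum_congr rfl fun p _ => h1 p,
    Finset.sum_add_distrib, hu, hw, ← Finset.sum_add_distrib]
  refine Finset.sum_congr rfl fun p hp => ?_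
  rw [← h2, show (n + 1 : ℝ) = p.1 + 2 * p.2 by exact_mod_cast (mem_degreePairs.1 hp).symm]

lemma sum_planeWaveCoeff {x : ℝ} (hx : x ∈ Icc (-1 : ℝ) 1) (n : ℕ) :
    ∑ p ∈ degreePairs n, planeWaveCoeff x p = (2 * x) ^ n / n.factorial * (Gamma (3 / 2))⁻¹ := by
  induction n with
  | zero =>
    have : degreePairs 0 = {(0, 0)} := by
      ext ⟨k, m⟩; rw [mem_degreePairs]; simp
    simp [this, planeWaveCoeff, legendreP_zero]
  | succ n ih =>
    have h := sum_planeWaveCoeff_succ hx n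
    rw [ih] at h
    have h0 : (n : ℝ) + 1 ≠ 0 := by positivity
    rw [← mul_right_inj' h0, h, Nat.factorial_succ]
    push_cast
    field_simp
    ring

/-- The expansion of a plane wave in spherical waves. -/
lemma hasSum_planeWave {ρ x : ℝ} (hρ : 0 < ρ) (hx : x ∈ Icc (-1 : ℝ) 1) :
    HasSum (fun k : ℕ => (-Complex.I) ^ k *
        (((2 * k + 1) * legendreP k x * besselJ (k + 1 / 2) ρ : ℝ) : ℂ))
      (((ρ / 2) ^ (1 / 2 : ℝ) * (Gamma (3 / 2))⁻¹ : ℝ) * Complex.exp (-Complex.I * (ρ * x))) := by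
  let f : ℕ × ℕ → ℂ := fun p => (-Complex.I) ^ p.1 *
    (((2 * p.1 + 1) * legendreP p.1 x * besselTerm (p.1 + 1 / 2) ρ p.2 : ℝ) : ℂ)
  have hf : ∀ p, f p = (-Complex.I) ^ (p.1 + 2 * p.2) *
      (((ρ / 2) ^ (1 / 2 : ℝ) * (ρ / 2) ^ (p.1 + 2 * p.2) * planeWaveCoeff x p : ℝ) : ℂ) := by
    rintro ⟨k, m⟩
    have h1 : (ρ / 2) ^ (2 * (m : ℝ) + (k + 1 / 2))
        = (ρ / 2) ^ (1 / 2 : ℝ) * (ρ / 2) ^ (k + 2 * m) := by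
      rw [← Real.rpow_natCast, ← Real.rpow_add (by positivity)]
      congr 1; push_cast; ring
    simp only [f, besselTerm, planeWaveCoeff, h1]
    rw [show (m : ℝ) + (k + 1 / 2) + 1 = m + k + 3 / 2 by ring, pow_add (-Complex.I),
      pow_mul (-Complex.I)]
    simp only [neg_sq, Complex.I_sq]
    push_cast
    ring
  have hg : Summable fun k : ℕ => (2 * k + 1 : ℝ) * (1 / 8) ^ k := by
    have h1 := summable_pow_mul_geometric_of_norm_lt_one 1 (r := (1 / 8 : ℝ)) (by norm_num)
    have h2 := summable_geometric_of_lt_one (r := (1 / 8 : ℝ)) (by norm_num) (by norm_num)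
    refine ((h1.mul_left 2).add h2).congr fun k => ?_
    ring
  have hsum : Summable f := by
    have hb : Summable fun p : ℕ × ℕ => ((2 * p.1 + 1 : ℝ) * (1 / 8) ^ p.1) *
        (rexp (4 * ρ) * ((ρ ^ 2 / (4 * (4 * ρ))) ^ p.2 / p.2.factorial)) :=
      hg.mul_of_nonneg ((Real.summable_pow_div_factorial _).mul_left _)
        (fun k => by positivity) (fun m => by positivity)
    refine .of_norm_bounded hb ?_
    rintro ⟨k, m⟩
    have h1 := abs_besselTerm_le (ν := k + 1 / 2) (x := 4 * ρ) (by positivity) hρ (by positivity) m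
    have h2 : (ρ / (2 * (4 * ρ))) ^ ((k : ℝ) + 1 / 2) ≤ (1 / 8) ^ k := by
      rw [show ρ / (2 * (4 * ρ)) = 1 / 8 by field_simp; norm_num, ← Real.rpow_natCast]
      exact Real.rpow_le_rpow_of_exponent_ge (by norm_num) (by norm_num) (by linarith)
    simp only [f]
    rw [norm_mul, norm_pow, norm_neg, Complex.norm_I, one_pow, one_mul, Complex.norm_real,
      norm_mul, norm_mul, Real.norm_of_nonneg (by positivity : (0 : ℝ) ≤ 2 * k + 1),
      Real.norm_eq_abs, Real.norm_eq_abs]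
    calc (2 * k + 1) * |legendreP k x| * |besselTerm (k + 1 / 2) ρ m|
        ≤ (2 * k + 1) * 1 * (rexp (4 * ρ) * (1 / 8) ^ k
            * ((ρ ^ 2 / (4 * (4 * ρ))) ^ m / m.factorial)) := by
          gcongr
          · exact abs_legendreP_le_one hx k
          · exact h1.trans (by gcongr)
      _ = _ := by ring
  have hfib := hsum.hasSum.tsum_fiberwise fun p : ℕ × ℕ => p.1 + 2 * p.2
  have hS : ∑' p, f p = ((ρ / 2) ^ (1 / 2 : ℝ) * (Gamma (3 / 2))⁻¹ : ℝ)
      * Complex.exp (-Complex.I * (ρ * x)) := by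
    refine hfib.unique ?_
    have he : HasSum (fun n : ℕ => (-Complex.I * (ρ * x)) ^ n / n.factorial)
        (Complex.exp (-Complex.I * (ρ * x))) := by
      rw [Complex.exp_eq_exp_ℂ]; exact NormedSpace.expSeries_div_hasSum_exp _
    refine Eq.mpr (congrArg (fun g => HasSum g _) (funext fun n => ?_))
      (he.mul_left (((ρ / 2) ^ (1 / 2 : ℝ) * (Gamma (3 / 2))⁻¹ : ℝ) : ℂ))
    have hset : (fun p : ℕ × ℕ => p.1 + 2 * p.2) ⁻¹' {n} = (degreePairs n : Set (ℕ × ℕ)) := by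
      ext p; simp [mem_degreePairs]
    rw [hset, Finset.tsum_subtype']
    have : ∀ p ∈ degreePairs n, f p = ((-Complex.I) ^ n *
        (((ρ / 2) ^ (1 / 2 : ℝ) * (ρ / 2) ^ n : ℝ) : ℂ)) * (planeWaveCoeff x p : ℂ) := by
      intro p hp
      rw [hf, mem_degreePairs.1 hp]; push_cast; ring
    rw [Finset.sum_congr rfl this, ← Finset.mul_sum, ← Complex.ofReal_sum, sum_planeWaveCoeff hx]
    push_cast
    rw [mul_pow (-Complex.I), mul_pow (ρ : ℂ), div_pow, mul_pow (2 : ℂ)]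
    field_simp
  rw [← hS]
  refine hsum.hasSum.prod_fiberwise fun k => ?_
  have := (summable_besselTerm (ν := k + 1 / 2) (by positivity) hρ).hasSum
  have h2 := Complex.hasSum_ofReal.2 (this.mul_left ((2 * k + 1) * legendreP k x))
  exact h2.mul_left ((-Complex.I) ^ k)

lemma sum_norm_sq_fourier_le {g : ℝ → ℂ} (hg : Continuous g) {M : ℝ}
    (hM : ∀ θ ∈ Icc (-π) π, ‖g θ‖ ≤ M) (N : ℕ) :
    ∑ k ∈ Finset.range N, ‖((2 * π)⁻¹ : ℝ) * ∫ θ in -π..π, Complex.exp (-(k * θ) * Complex.I) * g θ‖ ^ 2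
      ≤ M ^ 2 := by
  have hab : -π < π := by linarith [Real.pi_pos]
  have hm : MemLp g 2 (volume.restrict (Ioc (-π) π)) := by
    refine MemLp.of_bound (hg.aestronglyMeasurable) M ?_
    filter_upwards [ae_restrict_mem measurableSet_Ioc] with θ hθ using hM θ (Ioc_subset_Icc_self hθ)
  have h := hasSum_sq_fourierCoeffOn hab hm
  have hc : ∀ k : ℕ, fourierCoeffOn hab g k
      = ((2 * π)⁻¹ : ℝ) * ∫ θ in -π..π, Complex.exp (-(k * θ) * Complex.I) * g θ := by
    intro k
    rw [fourierCoeffOn_eq_integral, Complex.real_smul, show π - -π = 2 * π by ring, one_div]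
    congr 1
    refine intervalIntegral.integral_congr fun θ _ => ?_
    simp only [fourier_coe_apply, smul_eq_mul]
    congr 2
    have hπ : (π : ℂ) ≠ 0 := by exact_mod_cast Real.pi_ne_zero
    push_cast
    field_simp
  have hle : (π - -π)⁻¹ • ∫ θ in -π..π, ‖g θ‖ ^ 2 ≤ M ^ 2 := by
    have : ∫ θ in -π..π, ‖g θ‖ ^ 2 ≤ ∫ θ in -π..π, M ^ 2 := by
      refine intervalIntegral.integral_mono_on hab.le (Continuous.intervalIntegrable (by fun_prop) _ _)
        (Continuous.intervalIntegrable (by fun_prop) _ _) fun θ hθ => ?_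
      have := hM θ hθ
      gcongr
    rw [intervalIntegral.integral_const, smul_eq_mul] at this
    rw [smul_eq_mul, inv_mul_le_iff₀ (by linarith)]
    exact this
  refine le_trans ?_ hle
  simp_rw [← hc]
  rw [← h.tsum_eq]
  have hi : Function.Injective (fun k : ℕ => (k : ℤ)) := Nat.cast_injective
  calc ∑ k ∈ Finset.range N, ‖fourierCoeffOn hab g k‖ ^ 2
      = ∑ i ∈ (Finset.range N).map ⟨_, hi⟩, ‖fourierCoeffOn hab g i‖ ^ 2 := by simp
    _ ≤ _ := h.summable.sum_le_tsum _ fun _ _ => by positivity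

lemma norm_exp_mul_I_sub_one_sub_le (x : ℝ) :
    ‖Complex.exp (x * Complex.I) - 1 - x * Complex.I‖ ≤ 3 * x ^ 2 := by
  have hn : ‖(x : ℂ) * Complex.I‖ = |x| := by simp
  rcases le_total |x| 1 with h | h
  · have := Complex.norm_exp_sub_one_sub_id_le (x := x * Complex.I) (by rwa [hn])
    rw [hn, sq_abs] at this
    nlinarith [sq_nonneg x]
  · calc _ ≤ ‖Complex.exp (x * Complex.I)‖ + ‖(1 : ℂ)‖ + ‖(x : ℂ) * Complex.I‖ :=
          (norm_sub_le _ _).trans (by gcongr; exact norm_sub_le _ _)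
      _ = 2 + |x| := by rw [Complex.norm_exp_ofReal_mul_I, norm_one, hn]; ring
      _ ≤ 3 * x ^ 2 := by rw [← sq_abs]; nlinarith

/-- The circle part of Schläfli's integral. -/
noncomputable def schlafliCircle (ρ ν : ℝ) : ℂ :=
  ∫ θ in -π..π, Complex.exp ((ρ * sin θ - ν * θ : ℝ) * Complex.I)

/-- Minus the derivative of `schlafliCircle` in the order, up to a factor `I`. -/
noncomputable def schlafliCircleDeriv (ρ ν : ℝ) : ℂ :=
  ∫ θ in -π..π, θ * Complex.exp ((ρ * sin θ - ν * θ : ℝ) * Complex.I)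

/-- The ray part of Schläfli's integral. -/
noncomputable def schlafliRay (ρ ν : ℝ) : ℝ :=
  sin (π * ν) / π * ∫ t in Ioi (0 : ℝ), rexp (-ρ * sinh t - ν * t)

lemma norm_schlafliCircle_add_sub_le (ρ ν δ : ℝ) :
    ‖schlafliCircle ρ (ν + δ) - schlafliCircle ρ ν‖
      ≤ |δ| * ‖schlafliCircleDeriv ρ ν‖ + 6 * π ^ 3 * δ ^ 2 := by
  have h1 : schlafliCircle ρ (ν + δ) - schlafliCircle ρ ν + Complex.I * δ * schlafliCircleDeriv ρ ν
      = ∫ θ in -π..π, Complex.exp ((ρ * sin θ - ν * θ : ℝ) * Complex.I) *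
        (Complex.exp ((-(δ * θ) : ℝ) * Complex.I) - 1 - (-(δ * θ) : ℝ) * Complex.I) := by
    unfold schlafliCircle schlafliCircleDeriv
    rw [← intervalIntegral.integral_const_mul, ← intervalIntegral.integral_sub
      (Continuous.intervalIntegrable (by fun_prop) _ _)
      (Continuous.intervalIntegrable (by fun_prop) _ _), ← intervalIntegral.integral_add
      (Continuous.intervalIntegrable (by fun_prop) _ _)
      (Continuous.intervalIntegrable (by fun_prop) _ _)]
    refine intervalIntegral.integral_congr fun θ _ => ?_
    have : Complex.exp ((ρ * sin θ - (ν + δ) * θ : ℝ) * Complex.I)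
        = Complex.exp ((ρ * sin θ - ν * θ : ℝ) * Complex.I) *
          Complex.exp ((-(δ * θ) : ℝ) * Complex.I) := by
      rw [← Complex.exp_add]; congr 1; push_cast; ring
    simp only [this]
    push_cast
    ring
  have h2 : ‖∫ θ in -π..π, Complex.exp ((ρ * sin θ - ν * θ : ℝ) * Complex.I) *
        (Complex.exp ((-(δ * θ) : ℝ) * Complex.I) - 1 - (-(δ * θ) : ℝ) * Complex.I)‖
      ≤ 3 * (δ * π) ^ 2 * |π - -π| := by
    refine intervalIntegral.norm_integral_le_of_norm_le_const fun θ hθ => ?_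
    rw [uIoc_of_le (by linarith [Real.pi_pos])] at hθ
    rw [norm_mul, Complex.norm_exp_ofReal_mul_I, one_mul]
    refine (norm_exp_mul_I_sub_one_sub_le _).trans ?_
    have : θ ^ 2 ≤ π ^ 2 := sq_le_sq' hθ.1.le hθ.2
    rw [neg_sq, mul_pow, mul_pow]
    gcongr
  rw [← h1, abs_of_pos (by linarith [Real.pi_pos])] at h2
  have h3 : ‖Complex.I * δ * schlafliCircleDeriv ρ ν‖ = |δ| * ‖schlafliCircleDeriv ρ ν‖ := by
    rw [norm_mul, norm_mul, Complex.norm_I, one_mul, Complex.norm_real, Real.norm_eq_abs]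
  have h4 := norm_sub_le (schlafliCircle ρ (ν + δ) - schlafliCircle ρ ν
    + Complex.I * δ * schlafliCircleDeriv ρ ν) (Complex.I * δ * schlafliCircleDeriv ρ ν)
  rw [add_sub_cancel_right, h3] at h4
  linarith

lemma integrableOn_schlafliRay {ρ ν : ℝ} (hρ : 0 < ρ) (hν : 0 < ν) :
    IntegrableOn (fun t => rexp (-ρ * sinh t - ν * t)) (Ioi 0) := by
  refine (integrableOn_exp_mul_Ioi (neg_lt_zero.2 hν) 0).mono'
    (Continuous.aestronglyMeasurable (by fun_prop)) ?_
  filter_upwards [ae_restrict_mem measurableSet_Ioi] with t ht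
  have : 0 ≤ sinh t := Real.sinh_nonneg_iff.2 (le_of_lt ht)
  rw [Real.norm_of_nonneg (Real.exp_pos _).le, Real.exp_le_exp]
  nlinarith [mul_nonneg hρ.le this]

lemma integral_exp_neg_mul_Ioi {c : ℝ} (hc : 0 < c) : ∫ t in Ioi (0 : ℝ), rexp (-c * t) = c⁻¹ := by
  rw [integral_exp_mul_Ioi (neg_lt_zero.2 hc)]
  simp

lemma abs_schlafliRay_le {ρ ν : ℝ} (hρ : 0 < ρ) (hν : 0 < ν) : |schlafliRay ρ ν| ≤ ν⁻¹ := by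
  have h1 : ∫ t in Ioi (0 : ℝ), rexp (-ρ * sinh t - ν * t) ≤ ν⁻¹ := by
    rw [← integral_exp_neg_mul_Ioi hν]
    refine setIntegral_mono_on (integrableOn_schlafliRay hρ hν)
      (integrableOn_exp_mul_Ioi (neg_lt_zero.2 hν) 0) measurableSet_Ioi fun t ht => ?_
    have : 0 ≤ sinh t := Real.sinh_nonneg_iff.2 (le_of_lt ht)
    rw [Real.exp_le_exp]
    nlinarith [mul_nonneg hρ.le this]
  have h0 : 0 ≤ ∫ t in Ioi (0 : ℝ), rexp (-ρ * sinh t - ν * t) :=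
    integral_nonneg fun t => (Real.exp_pos _).le
  rw [schlafliRay, abs_mul, abs_of_nonneg h0, abs_div, abs_of_pos Real.pi_pos]
  have : |sin (π * ν)| / π ≤ 1 := by
    rw [div_le_one Real.pi_pos]
    linarith [Real.abs_sin_le_one (π * ν), Real.pi_gt_three]
  calc _ ≤ 1 * ν⁻¹ := by gcongr
    _ = _ := one_mul _

lemma abs_schlafliRay_add_sub_le {ρ ν δ : ℝ} (hρ : 0 < ρ) (hν : 1 / 2 ≤ ν) (hδ : 0 ≤ δ) :
    |schlafliRay ρ (ν + δ) - schlafliRay ρ ν| ≤ 6 * δ * ν⁻¹ := by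
  have hν0 : 0 < ν := by linarith
  have e : schlafliRay ρ (ν + δ) - schlafliRay ρ ν = π⁻¹ * ∫ t in Ioi (0 : ℝ),
      (sin (π * (ν + δ)) * rexp (-ρ * sinh t - (ν + δ) * t)
        - sin (π * ν) * rexp (-ρ * sinh t - ν * t)) := by
    rw [integral_sub ((integrableOn_schlafliRay hρ (by linarith)).const_mul _)
      ((integrableOn_schlafliRay hρ hν0).const_mul _), integral_const_mul, integral_const_mul]
    simp only [schlafliRay]
    ring
  have hb : ‖∫ t in Ioi (0 : ℝ), (sin (π * (ν + δ)) * rexp (-ρ * sinh t - (ν + δ) * t)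
        - sin (π * ν) * rexp (-ρ * sinh t - ν * t))‖
      ≤ ∫ t in Ioi (0 : ℝ), 8 * δ * rexp (-(ν / 2) * t) := by
    refine norm_integral_le_of_norm_le
      ((integrableOn_exp_mul_Ioi (by linarith : -(ν / 2) < 0) 0).const_mul _) ?_
    filter_upwards [ae_restrict_mem measurableSet_Ioi] with t ht
    have ht : 0 < t := ht
    have hs : 0 ≤ sinh t := Real.sinh_nonneg_iff.2 ht.le
    set E := rexp (-ρ * sinh t - ν * t) with hE
    have hE1 : E ≤ rexp (-(ν / 2) * t) * rexp (-(ν / 2 * t)) := by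
      rw [← Real.exp_add, Real.exp_le_exp]
      nlinarith [mul_nonneg hρ.le hs]
    have hd : rexp (-ρ * sinh t - (ν + δ) * t) = E * rexp (-(δ * t)) := by
      rw [hE, ← Real.exp_add]; congr 1; ring
    have h1 : |sin (π * (ν + δ)) - sin (π * ν)| ≤ π * δ := by
      refine (Real.abs_sin_sub_sin_le _ _).trans (le_of_eq ?_)
      rw [← mul_sub, add_sub_cancel_left, abs_of_nonneg (by positivity)]
    have h2 : |1 - rexp (-(δ * t))| ≤ δ * t := by
      rw [abs_of_nonneg (by rw [sub_nonneg, Real.exp_le_one_iff, neg_nonpos]; positivity)]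
      linarith [Real.add_one_le_exp (-(δ * t))]
    have h3 : rexp (-(δ * t)) ≤ 1 := by rw [Real.exp_le_one_iff, neg_nonpos]; positivity
    have h4 : (π + t) * rexp (-(ν / 2 * t)) ≤ 8 := by
      rw [Real.exp_neg, ← div_eq_mul_inv, div_le_iff₀ (Real.exp_pos _)]
      nlinarith [Real.add_one_le_exp (ν / 2 * t), Real.pi_lt_four]
    rw [hd, show sin (π * (ν + δ)) * (E * rexp (-(δ * t))) - sin (π * ν) * E
      = E * ((sin (π * (ν + δ)) - sin (π * ν)) * rexp (-(δ * t))
        - sin (π * ν) * (1 - rexp (-(δ * t)))) by ring, norm_mul,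
      Real.norm_of_nonneg (Real.exp_pos _).le]
    calc E * ‖(sin (π * (ν + δ)) - sin (π * ν)) * rexp (-(δ * t))
          - sin (π * ν) * (1 - rexp (-(δ * t)))‖
        ≤ E * (π * δ * 1 + 1 * (δ * t)) := by
          gcongr
          refine (norm_sub_le _ _).trans ?_
          rw [norm_mul, norm_mul, Real.norm_of_nonneg (Real.exp_pos _).le]
          gcongr
          · exact h1
          · exact Real.abs_sin_le_one _
          · exact h2
      _ ≤ rexp (-(ν / 2) * t) * rexp (-(ν / 2 * t)) * (π * δ * 1 + 1 * (δ * t)) := by gcongr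
      _ = δ * rexp (-(ν / 2) * t) * ((π + t) * rexp (-(ν / 2 * t))) := by ring
      _ ≤ δ * rexp (-(ν / 2) * t) * 8 := by gcongr
      _ = _ := by ring
  rw [integral_const_mul, integral_exp_neg_mul_Ioi (by linarith), Real.norm_eq_abs] at hb
  rw [e, abs_mul, abs_of_pos (by positivity : 0 < π⁻¹)]
  calc _ ≤ (3 : ℝ)⁻¹ * (8 * δ * (ν / 2)⁻¹) := by
        gcongr
        exact Real.pi_gt_three.le
    _ = 16 / 3 * (δ * ν⁻¹) := by field_simp; ring
    _ ≤ 6 * (δ * ν⁻¹) := by gcongr; norm_num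
    _ = _ := by ring

/-- The phase `i ^ (-ν)`. -/
noncomputable def besselPhase (ν : ℝ) : ℂ := Complex.exp (-(Complex.I * π * ν) / 2)

lemma besselPhase_eq (ν : ℝ) : besselPhase ν = Complex.exp (Complex.I * (-(π * ν / 2) : ℝ)) := by
  unfold besselPhase; congr 1; push_cast; ring

lemma norm_besselPhase (ν : ℝ) : ‖besselPhase ν‖ = 1 := by
  rw [besselPhase_eq, mul_comm, Complex.norm_exp_ofReal_mul_I]

lemma norm_besselPhase_add_sub_le (ν δ : ℝ) (hδ : 0 ≤ δ) :
    ‖besselPhase (ν + δ) - besselPhase ν‖ ≤ 2 * δ := by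
  have : besselPhase (ν + δ) - besselPhase ν
      = besselPhase ν * (Complex.exp (Complex.I * (-(π * δ / 2) : ℝ)) - 1) := by
    rw [besselPhase_eq, besselPhase_eq, mul_sub, ← Complex.exp_add, mul_one]
    congr 2; push_cast; ring
  rw [this, norm_mul, norm_besselPhase, one_mul]
  refine Real.norm_exp_I_mul_ofReal_sub_one_le.trans ?_
  rw [norm_neg, Real.norm_of_nonneg (by positivity)]
  nlinarith [Real.pi_lt_four]

lemma besselPhase_half_int (k : ℕ) :
    besselPhase (k + 1 / 2) = besselPhase (1 / 2) * (-Complex.I) ^ k := by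
  have : (-Complex.I) = Complex.exp (-(π / 2 * Complex.I)) := by
    rw [Complex.exp_neg, Complex.exp_pi_div_two_mul_I, Complex.inv_I]
  rw [this, ← Complex.exp_nat_mul, besselPhase, besselPhase, ← Complex.exp_add]
  congr 1; push_cast; ring

lemma betaCoef_spec {a : ℝ} (ha : 0 < a) (k : ℕ) : ∃ δ, 0 ≤ δ ∧ betaCoef a k = (k + 1 / 2) + δ ∧
    δ * (2 * k + 1) ≤ a := by
  have h0 : (0 : ℝ) ≤ k + 1 / 2 := by positivity
  have h1 : (k : ℝ) + 1 / 2 ≤ betaCoef a k := Real.le_sqrt_of_sq_le (by linarith)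
  have h2 : betaCoef a k ^ 2 = ((k : ℝ) + 1 / 2) ^ 2 + a := Real.sq_sqrt (by positivity)
  refine ⟨betaCoef a k - (k + 1 / 2), by linarith, by ring, ?_⟩
  nlinarith

lemma half_le_betaCoef {a : ℝ} (ha : 0 < a) (k : ℕ) : (k : ℝ) + 1 / 2 ≤ betaCoef a k :=
  Real.le_sqrt_of_sq_le (by linarith)

/-- The difference between the perturbed and the half-integer order terms. -/
noncomputable def besselDiff (a ρ : ℝ) (k : ℕ) : ℂ :=
  besselPhase (betaCoef a k) * besselJ (betaCoef a k) ρ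
    - besselPhase (k + 1 / 2) * besselJ (k + 1 / 2) ρ

lemma besselJ_eq_circle_sub_ray {ν ρ : ℝ} (hν : 0 < ν) (hρ : 0 < ρ) :
    (besselJ ν ρ : ℂ) = ((2 * π)⁻¹ : ℝ) * schlafliCircle ρ ν - (schlafliRay ρ ν : ℝ) :=
  besselJ_eq_schlafli hν hρ

lemma norm_besselDiff_le {a ρ : ℝ} (ha : 0 < a) (hρ : 0 < ρ) (k : ℕ) :
    (2 * k + 1) * ‖besselDiff a ρ k‖ ≤ a * (‖((2 * π)⁻¹ : ℝ) * schlafliCircleDeriv ρ (k + 1 / 2)‖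
      + 2 * ‖((2 * π)⁻¹ : ℝ) * schlafliCircle ρ (k + 1 / 2)‖ + (30 * a + 8) * ((k : ℝ) + 1 / 2)⁻¹) := by
  obtain ⟨δ, hδ, hβ, hδa⟩ := betaCoef_spec ha k
  rw [besselDiff, hβ]
  set ν : ℝ := k + 1 / 2 with hν
  have hk : (0 : ℝ) ≤ k := by positivity
  have hν0 : 0 < ν := by positivity
  have hνh : 1 / 2 ≤ ν := by linarith
  set c : ℝ := (2 * π)⁻¹ with hc
  have hc0 : 0 < c := by positivity
  have hJ := besselJ_eq_circle_sub_ray hν0 hρ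
  have hJ' := besselJ_eq_circle_sub_ray (by linarith : 0 < ν + δ) hρ
  rw [← hc] at hJ hJ'
  have h1 : ‖(besselJ (ν + δ) ρ : ℂ) - besselJ ν ρ‖
      ≤ δ * ‖c * schlafliCircleDeriv ρ ν‖ + 30 * δ ^ 2 + 6 * δ * ν⁻¹ := by
    have e : (besselJ (ν + δ) ρ : ℂ) - besselJ ν ρ
        = c * (schlafliCircle ρ (ν + δ) - schlafliCircle ρ ν)
          - ((schlafliRay ρ (ν + δ) - schlafliRay ρ ν : ℝ) : ℂ) := by
      rw [hJ, hJ']; push_cast; ring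
    have hr := abs_schlafliRay_add_sub_le hρ hνh hδ
    have hcirc := norm_schlafliCircle_add_sub_le ρ ν δ
    rw [abs_of_nonneg hδ] at hcirc
    have hπ2 : c * (6 * π ^ 3 * δ ^ 2) ≤ 30 * δ ^ 2 := by
      have : c * (6 * π ^ 3 * δ ^ 2) = 3 * π ^ 2 * δ ^ 2 := by rw [hc]; field_simp; ring
      rw [this]
      have : π ^ 2 ≤ 10 := by nlinarith [Real.pi_lt_d2, Real.pi_pos]
      nlinarith [sq_nonneg δ]
    rw [e]
    refine (norm_sub_le _ _).trans ?_
    rw [norm_mul, norm_mul, Complex.norm_real, Complex.norm_real, Real.norm_of_nonneg hc0.le,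
      Real.norm_eq_abs]
    nlinarith [mul_le_mul_of_nonneg_left hcirc hc0.le]
  have h2 : ‖(besselJ ν ρ : ℂ)‖ ≤ ‖c * schlafliCircle ρ ν‖ + ν⁻¹ := by
    rw [hJ]
    refine (norm_sub_le _ _).trans ?_
    rw [Complex.norm_real (schlafliRay ρ ν), Real.norm_eq_abs]
    gcongr
    exact abs_schlafliRay_le hρ hν0
  have h3 : ‖besselPhase (ν + δ) * besselJ (ν + δ) ρ - besselPhase ν * besselJ ν ρ‖
      ≤ δ * (‖c * schlafliCircleDeriv ρ ν‖ + 2 * ‖c * schlafliCircle ρ ν‖ + 30 * δ + 8 * ν⁻¹) := by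
    rw [show besselPhase (ν + δ) * besselJ (ν + δ) ρ - besselPhase ν * besselJ ν ρ
      = besselPhase (ν + δ) * ((besselJ (ν + δ) ρ : ℂ) - besselJ ν ρ)
        + (besselPhase (ν + δ) - besselPhase ν) * besselJ ν ρ by ring]
    refine (norm_add_le _ _).trans ?_
    rw [norm_mul, norm_mul, norm_besselPhase, one_mul]
    have := mul_le_mul (norm_besselPhase_add_sub_le ν δ hδ) h2 (norm_nonneg _) (by positivity)
    nlinarith
  have hδν : δ ≤ a * ν⁻¹ := by
    rw [← div_eq_mul_inv, le_div_iff₀ hν0]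
    nlinarith
  calc _ ≤ (2 * k + 1) * (δ * (‖c * schlafliCircleDeriv ρ ν‖ + 2 * ‖c * schlafliCircle ρ ν‖
          + 30 * δ + 8 * ν⁻¹)) := by gcongr
    _ = δ * (2 * k + 1) * (‖c * schlafliCircleDeriv ρ ν‖ + 2 * ‖c * schlafliCircle ρ ν‖
          + 30 * δ + 8 * ν⁻¹) := by ring
    _ ≤ a * (‖c * schlafliCircleDeriv ρ ν‖ + 2 * ‖c * schlafliCircle ρ ν‖
          + 30 * (a * ν⁻¹) + 8 * ν⁻¹) := by gcongr
    _ = _ := by ring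

lemma sum_sq_schlafliCircle_le (ρ : ℝ) (N : ℕ) :
    ∑ k ∈ Finset.range N, ‖((2 * π)⁻¹ : ℝ) * schlafliCircle ρ (k + 1 / 2)‖ ^ 2 ≤ 1 := by
  have := sum_norm_sq_fourier_le (g := fun θ => Complex.exp ((ρ * sin θ - 1 / 2 * θ : ℝ) * Complex.I))
    (by fun_prop) (M := 1) (fun θ _ => (Complex.norm_exp_ofReal_mul_I _).le) N
  rw [one_pow] at this
  refine le_trans (le_of_eq ?_) this
  refine Finset.sum_congr rfl fun k _ => ?_
  congr 3
  refine intervalIntegral.integral_congr fun θ _ => ?_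
  rw [← Complex.exp_add]
  congr 1; push_cast; ring

lemma sum_sq_schlafliCircleDeriv_le (ρ : ℝ) (N : ℕ) :
    ∑ k ∈ Finset.range N, ‖((2 * π)⁻¹ : ℝ) * schlafliCircleDeriv ρ (k + 1 / 2)‖ ^ 2 ≤ π ^ 2 := by
  have := sum_norm_sq_fourier_le
    (g := fun θ => θ * Complex.exp ((ρ * sin θ - 1 / 2 * θ : ℝ) * Complex.I))
    (by fun_prop) (M := π) (fun θ hθ => by
      rw [norm_mul, Complex.norm_exp_ofReal_mul_I, mul_one, Complex.norm_real, Real.norm_eq_abs]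
      exact abs_le.2 hθ) N
  refine le_trans (le_of_eq ?_) this
  refine Finset.sum_congr rfl fun k _ => ?_
  congr 3
  refine intervalIntegral.integral_congr fun θ _ => ?_
  rw [mul_left_comm, ← Complex.exp_add]
  congr 2; push_cast; ring

lemma sum_sq_inv_half_int_le (N : ℕ) :
    ∑ k ∈ Finset.range N, ((k : ℝ) + 1 / 2)⁻¹ ^ 2 ≤ 4 * ∑' k : ℕ, 1 / ((k + 1 : ℕ) : ℝ) ^ 2 := by
  have hs : Summable fun k : ℕ => 1 / ((k + 1 : ℕ) : ℝ) ^ 2 :=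
    (summable_nat_add_iff (f := fun k : ℕ => 1 / (k : ℝ) ^ 2) 1).2
      (Real.summable_one_div_nat_pow.2 one_lt_two)
  refine le_trans ?_ (mul_le_mul_of_nonneg_left
    (hs.sum_le_tsum (Finset.range N) fun k _ => by positivity) (by norm_num : (0 : ℝ) ≤ 4))
  rw [Finset.mul_sum]
  refine Finset.sum_le_sum fun k _ => ?_
  rw [inv_pow, ← one_div, mul_one_div, div_le_div_iff₀ (by positivity) (by positivity)]
  push_cast
  nlinarith [(by positivity : (0 : ℝ) ≤ k)]

lemma exists_sum_sq_besselDiff_le {a : ℝ} (ha : 0 < a) : ∃ C ≥ 0, ∀ ρ > 0, ∀ N : ℕ,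
    ∑ k ∈ Finset.range N, ((2 * k + 1) * ‖besselDiff a ρ k‖) ^ 2 ≤ C := by
  set Z : ℝ := ∑' k : ℕ, 1 / ((k + 1 : ℕ) : ℝ) ^ 2 with hZ
  have hZ0 : 0 ≤ Z := tsum_nonneg fun k => by positivity
  refine ⟨a ^ 2 * (3 * π ^ 2 + 12 * 1 + 3 * (30 * a + 8) ^ 2 * (4 * Z)), by positivity,
    fun ρ hρ N => ?_⟩
  calc ∑ k ∈ Finset.range N, ((2 * k + 1) * ‖besselDiff a ρ k‖) ^ 2
      ≤ ∑ k ∈ Finset.range N, a ^ 2 * (3 * ‖((2 * π)⁻¹ : ℝ) * schlafliCircleDeriv ρ (k + 1 / 2)‖ ^ 2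
        + 12 * ‖((2 * π)⁻¹ : ℝ) * schlafliCircle ρ (k + 1 / 2)‖ ^ 2
        + 3 * (30 * a + 8) ^ 2 * ((k : ℝ) + 1 / 2)⁻¹ ^ 2) := by
        refine Finset.sum_le_sum fun k _ => ?_
        refine (pow_le_pow_left₀ (by positivity) (norm_besselDiff_le ha hρ k) 2).trans ?_
        rw [mul_pow]
        gcongr
        generalize ‖((2 * π)⁻¹ : ℝ) * schlafliCircleDeriv ρ (k + 1 / 2)‖ = x
        generalize ‖((2 * π)⁻¹ : ℝ) * schlafliCircle ρ (k + 1 / 2)‖ = y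
        generalize ((k : ℝ) + 1 / 2)⁻¹ = z
        generalize 30 * a + 8 = w
        nlinarith [sq_nonneg (x - 2 * y), sq_nonneg (x - w * z), sq_nonneg (2 * y - w * z)]
    _ = a ^ 2 * (3 * ∑ k ∈ Finset.range N, ‖((2 * π)⁻¹ : ℝ) * schlafliCircleDeriv ρ (k + 1 / 2)‖ ^ 2
        + 12 * ∑ k ∈ Finset.range N, ‖((2 * π)⁻¹ : ℝ) * schlafliCircle ρ (k + 1 / 2)‖ ^ 2
        + 3 * (30 * a + 8) ^ 2 * ∑ k ∈ Finset.range N, ((k : ℝ) + 1 / 2)⁻¹ ^ 2) := by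
        simp only [Finset.mul_sum, ← Finset.sum_add_distrib]
    _ ≤ _ := by
        gcongr
        · exact sum_sq_schlafliCircleDeriv_le ρ N
        · exact sum_sq_schlafliCircle_le ρ N
        · exact sum_sq_inv_half_int_le N

lemma summable_odd_mul_geometric : Summable fun k : ℕ => (2 * k + 1 : ℝ) * (1 / 2) ^ k := by
  have h1 := summable_pow_mul_geometric_of_norm_lt_one 1 (r := (1 / 2 : ℝ)) (by norm_num)
  have h2 := summable_geometric_of_lt_one (r := (1 / 2 : ℝ)) (by norm_num) (by norm_num)
  refine ((h1.mul_left 2).add h2).congr fun k => ?_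
  ring

lemma abs_besselJ_le_of_le_one {ρ ν : ℝ} {k : ℕ} (hρ : 0 < ρ) (hρ1 : ρ ≤ 1)
    (hν : (k : ℝ) + 1 / 2 ≤ ν) : |besselJ ν ρ| ≤ rexp 2 * ρ ^ (1 / 2 : ℝ) * (1 / 2) ^ k := by
  have hν0 : 0 ≤ ν := le_trans (by positivity) hν
  refine (abs_besselJ_le hν0 hρ one_pos).trans ?_
  have h1 : (ρ / (2 * 1)) ^ ν ≤ ρ ^ (1 / 2 : ℝ) * (1 / 2) ^ k := by
    calc (ρ / (2 * 1)) ^ ν ≤ (ρ / (2 * 1)) ^ ((k : ℝ) + 1 / 2) :=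
          Real.rpow_le_rpow_of_exponent_ge (by positivity) (by linarith) hν
      _ = (ρ / (2 * 1)) ^ (1 / 2 : ℝ) * (ρ / (2 * 1)) ^ k := by
          rw [add_comm, Real.rpow_add (by positivity), Real.rpow_natCast]
      _ ≤ _ := by gcongr <;> linarith
  rw [mul_assoc]
  gcongr
  nlinarith

lemma abs_besselJ_le_exp {ρ ν : ℝ} {k : ℕ} (hρ : 0 < ρ) (hν : (k : ℝ) + 1 / 2 ≤ ν) :
    |besselJ ν ρ| ≤ rexp (5 * ρ) * (1 / 8) ^ k := by
  have hν0 : 0 ≤ ν := le_trans (by positivity) hν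
  refine (abs_besselJ_le hν0 hρ (by positivity : 0 < 4 * ρ)).trans ?_
  rw [show ρ / (2 * (4 * ρ)) = 1 / 8 by field_simp; norm_num,
    show ρ ^ 2 / (4 * (4 * ρ)) = ρ / 16 by field_simp; norm_num]
  gcongr
  · linarith
  · rw [← Real.rpow_natCast]
    exact Real.rpow_le_rpow_of_exponent_ge (by norm_num) (by norm_num) (by linarith)

lemma abs_besselJ_le_of_five_mul_le {ρ ν : ℝ} {k : ℕ} (hρ : 0 < ρ) (hk : 5 * ρ ≤ k)
    (hν : (k : ℝ) + 1 / 2 ≤ ν) : |besselJ ν ρ| ≤ (1 / 2) ^ k := by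
  refine (abs_besselJ_le_exp hρ hν).trans ?_
  calc rexp (5 * ρ) * (1 / 8) ^ k ≤ rexp k * (1 / 8) ^ k := by gcongr
    _ = (rexp 1 * (1 / 8)) ^ k := by rw [mul_pow, ← Real.exp_nat_mul, mul_one]
    _ ≤ _ := by
      gcongr
      linarith [Real.exp_one_lt_d9]

lemma norm_zonalFactor_le {x : ℝ} (hx : x ∈ Icc (-1 : ℝ) 1) (k : ℕ) :
    ‖(((2 * (k : ℝ) + 1) / (4 * π) : ℝ) : ℂ) * (legendreP k x : ℂ)‖ ≤ 2 * k + 1 := by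
  rw [norm_mul, Complex.norm_real, Complex.norm_real, Real.norm_of_nonneg (by positivity),
    Real.norm_eq_abs]
  calc _ ≤ (2 * (k : ℝ) + 1) / 1 * 1 := by
        gcongr
        · linarith [Real.pi_gt_three]
        · exact abs_legendreP_le_one hx k
    _ = _ := by ring

lemma norm_besselPhase_mul (ν x : ℝ) : ‖besselPhase ν * (x : ℂ)‖ = |x| := by
  rw [norm_mul, norm_besselPhase, one_mul, Complex.norm_real, Real.norm_eq_abs]

lemma hasSum_unperturbed {ρ x : ℝ} (hρ : 0 < ρ) (hx : x ∈ Icc (-1 : ℝ) 1) :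
    ∃ S : ℂ, ‖S‖ ≤ (Gamma (3 / 2))⁻¹ * ρ ^ (1 / 2 : ℝ) ∧ HasSum (fun k : ℕ =>
      besselPhase (k + 1 / 2) * (besselJ (k + 1 / 2) ρ : ℂ) *
        ((((2 * (k : ℝ) + 1) / (4 * π) : ℝ) : ℂ) * (legendreP k x : ℂ))) S := by
  have h := (hasSum_planeWave hρ hx).mul_left (besselPhase (1 / 2) * ((4 * π)⁻¹ : ℝ))
  refine ⟨_, ?_, Eq.mpr (congrArg (fun g => HasSum g _) (funext fun k => ?_)) h⟩
  · have hG : 0 < Gamma (3 / 2) := Real.Gamma_pos_of_pos (by norm_num)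
    have hE : ‖Complex.exp (-Complex.I * (ρ * x))‖ = 1 := by
      rw [show -Complex.I * (ρ * x) = ((-(ρ * x) : ℝ) : ℂ) * Complex.I by push_cast; ring,
        Complex.norm_exp_ofReal_mul_I]
    rw [norm_mul, norm_mul _ (Complex.exp _), hE, norm_besselPhase_mul, Complex.norm_real,
      Real.norm_of_nonneg (by positivity), abs_of_pos (by positivity), mul_one]
    have h4 : (4 * π)⁻¹ ≤ 1 := inv_le_one_of_one_le₀ (by linarith [Real.pi_gt_three])
    calc _ ≤ 1 * (ρ ^ (1 / 2 : ℝ) * (Gamma (3 / 2))⁻¹) := by gcongr; linarith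
      _ = _ := by ring
  · rw [besselPhase_half_int]
    push_cast
    ring

theorem stmt0 (a : ℝ) (ha : 0 < a) :
    ∃ C > 0, ∀ ρ : ℝ, 0 < ρ → ∀ τ : ℝ, τ ∈ Set.Icc (-1 : ℝ) 1 →
      ‖∑' k : ℕ, Complex.exp (-(Complex.I * Real.pi * (betaCoef a k : ℂ)) / 2) *
          (besselJ (betaCoef a k) ρ : ℂ) *
          (((2 * (k : ℝ) + 1) / (4 * Real.pi) : ℝ) : ℂ) *
          ((legendreP k τ : ℝ) : ℂ)‖ ≤ C * ρ ^ ((1 : ℝ) / 2) := by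
  obtain ⟨B, hB0, hB⟩ := exists_sum_sq_besselDiff_le ha
  set G : ℝ := ∑' k : ℕ, (2 * k + 1 : ℝ) * (1 / 2) ^ k with hG
  have hGs : HasSum (fun k : ℕ => (2 * k + 1 : ℝ) * (1 / 2) ^ k) G := summable_odd_mul_geometric.hasSum
  have hG0 : 0 ≤ G := hGs.nonneg fun k => by positivity
  have hΓ : 0 < (Gamma (3 / 2))⁻¹ := inv_pos.2 (Real.Gamma_pos_of_pos (by norm_num))
  refine ⟨(Gamma (3 / 2))⁻¹ + (√(6 * B) + 2 * G) + rexp 2 * G, by positivity, fun ρ hρ τ hτ => ?_⟩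
  set z : ℕ → ℂ := fun k => (((2 * (k : ℝ) + 1) / (4 * π) : ℝ) : ℂ) * (legendreP k τ : ℂ) with hz
  have hzn : ∀ k, ‖z k‖ ≤ 2 * k + 1 := norm_zonalFactor_le hτ
  have hterm : ∀ k : ℕ, Complex.exp (-(Complex.I * π * (betaCoef a k : ℂ)) / 2) *
      (besselJ (betaCoef a k) ρ : ℂ) * (((2 * (k : ℝ) + 1) / (4 * π) : ℝ) : ℂ) *
      ((legendreP k τ : ℝ) : ℂ) = besselPhase (betaCoef a k) * besselJ (betaCoef a k) ρ * z k :=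
    fun k => mul_assoc _ _ _
  simp_rw [hterm]
  have hR : 0 < ρ ^ (1 / 2 : ℝ) := by positivity
  rcases le_total ρ 1 with h1 | h1
  · have hb := tsum_of_norm_bounded (f := fun k => besselPhase (betaCoef a k) *
        besselJ (betaCoef a k) ρ * z k) (hGs.mul_left (rexp 2 * ρ ^ (1 / 2 : ℝ))) fun k => by
      rw [norm_mul, norm_besselPhase_mul]
      calc _ ≤ (rexp 2 * ρ ^ (1 / 2 : ℝ) * (1 / 2) ^ k) * (2 * k + 1) :=
            mul_le_mul (abs_besselJ_le_of_le_one hρ h1 (half_le_betaCoef ha k)) (hzn k)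
              (norm_nonneg _) (by positivity)
        _ = _ := by ring
    refine hb.trans ?_
    have : 0 ≤ ((Gamma (3 / 2))⁻¹ + (√(6 * B) + 2 * G)) * ρ ^ (1 / 2 : ℝ) := by positivity
    linarith
  · obtain ⟨S, hS, hSsum⟩ := hasSum_unperturbed hρ hτ
    set N : ℕ := ⌈5 * ρ⌉₊ with hN
    have hNρ : (N : ℝ) ≤ 6 * ρ := by
      have := Nat.ceil_lt_add_one (by positivity : 0 ≤ 5 * ρ)
      linarith
    let h : ℕ → ℝ := fun k => if k < N then (2 * k + 1) * ‖besselDiff a ρ k‖ else 0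
    have hh : HasSum h (∑ k ∈ Finset.range N, (2 * k + 1) * ‖besselDiff a ρ k‖) := by
      have : HasSum h (∑ k ∈ Finset.range N, h k) :=
        hasSum_sum_of_ne_finset_zero fun k hk => if_neg (by simpa using hk)
      rwa [Finset.sum_congr rfl fun k hk => if_pos (Finset.mem_range.1 hk)] at this
    have hd : ∀ k, ‖besselDiff a ρ k * z k‖ ≤ h k + 2 * ((2 * k + 1) * (1 / 2) ^ k) := by
      intro k
      rw [norm_mul]
      by_cases hk : k < N
      · simp only [h, if_pos hk]
        have := mul_le_mul_of_nonneg_left (hzn k) (norm_nonneg (besselDiff a ρ k))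
        have : 0 ≤ 2 * ((2 * k + 1) * (1 / 2 : ℝ) ^ k) := by positivity
        linarith
      · simp only [h, if_neg hk, zero_add]
        have hk5 : 5 * ρ ≤ k := (Nat.le_ceil _).trans (by exact_mod_cast not_lt.1 hk)
        have : ‖besselDiff a ρ k‖ ≤ (1 / 2) ^ k + (1 / 2) ^ k := by
          refine (norm_sub_le _ _).trans ?_
          rw [norm_besselPhase_mul, norm_besselPhase_mul]
          exact add_le_add (abs_besselJ_le_of_five_mul_le hρ hk5 (half_le_betaCoef ha k))
            (abs_besselJ_le_of_five_mul_le hρ hk5 le_rfl)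
        calc _ ≤ ((1 / 2) ^ k + (1 / 2) ^ k) * (2 * k + 1 : ℝ) :=
              mul_le_mul this (hzn k) (norm_nonneg _) (by positivity)
          _ = _ := by ring
    have hmaj := hh.add (hGs.mul_left 2)
    have hds : Summable fun k => besselDiff a ρ k * z k := .of_norm_bounded hmaj.summable hd
    have hdb := tsum_of_norm_bounded hmaj hd
    have hsplit : ∑' k, besselPhase (betaCoef a k) * besselJ (betaCoef a k) ρ * z k
        = S + ∑' k, besselDiff a ρ k * z k := by
      rw [← (hSsum.add hds.hasSum).tsum_eq]
      refine tsum_congr fun k => ?_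
      simp only [besselDiff, hz]
      ring
    have hhead : ∑ k ∈ Finset.range N, (2 * k + 1) * ‖besselDiff a ρ k‖
        ≤ √(6 * B) * ρ ^ (1 / 2 : ℝ) := by
      rw [← Real.sqrt_eq_rpow, ← Real.sqrt_mul (by positivity)]
      refine Real.le_sqrt_of_sq_le ?_
      have hcs := Finset.sum_mul_sq_le_sq_mul_sq (Finset.range N) (fun _ => (1 : ℝ))
        (fun k => (2 * k + 1) * ‖besselDiff a ρ k‖)
      simp only [one_mul, one_pow, Finset.sum_const, Finset.card_range, nsmul_eq_mul, mul_one] at hcs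
      refine hcs.trans ?_
      calc _ ≤ 6 * ρ * B := by gcongr; exact hB ρ hρ N
        _ = _ := by ring
    have hR1 : 1 ≤ ρ ^ (1 / 2 : ℝ) := Real.one_le_rpow h1 (by norm_num)
    rw [hsplit]
    refine (norm_add_le _ _).trans ?_
    have : 0 ≤ rexp 2 * G * ρ ^ (1 / 2 : ℝ) := by positivity
    nlinarith [mul_nonneg hG0 (sub_nonneg.2 hR1)]
end

section
/- Let a ≥ 0 and for each k ∈ ℕ set β_k := √((k+1/2)² + a). For every ρ > 0 the series Σ_{k=0}^∞ (2k+1) |J_{β_k}(ρ)| and Σ_{k=0}^∞ (2k+1) I_{β_k}(ρ) converge (so the Schrödinger and heat kernel series of the paper are absolutely convergent at every point). -/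
/-- The modified Bessel function of the first kind `I_ν(ρ)`, defined by its power series. -/
noncomputable def besselI (ν ρ : ℝ) : ℝ :=
  ∑' m : ℕ, (ρ / 2) ^ (2 * (m : ℝ) + ν) /
    ((m.factorial : ℝ) * Real.Gamma ((m : ℝ) + ν + 1))

theorem bessel_term_bound {x ν : ℝ} {k : ℕ} (hx : 0 < x) (hk : 1 ≤ k) (hν : (k : ℝ) ≤ ν) (m : ℕ) :
    x ^ (2 * (m : ℝ) + ν) / ((m.factorial : ℝ) * Real.Gamma ((m : ℝ) + ν + 1)) ≤
      x ^ ν / (k.factorial : ℝ) * ((x ^ 2) ^ m / (m.factorial : ℝ)) := by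
  have hk' : (1 : ℝ) ≤ k := by exact_mod_cast hk
  have hm : (0 : ℝ) ≤ m := m.cast_nonneg
  have hΓ : (k.factorial : ℝ) ≤ Real.Gamma ((m : ℝ) + ν + 1) := by
    rw [← Real.Gamma_nat_eq_factorial]
    exact Real.Gamma_strictMonoOn_Ici.monotoneOn (Set.mem_Ici.2 (by linarith))
      (Set.mem_Ici.2 (by linarith)) (by linarith)
  have hpow : x ^ (2 * (m : ℝ) + ν) = x ^ ν * (x ^ 2) ^ m := by
    rw [Real.rpow_add hx, ← pow_mul, ← Real.rpow_natCast x (2 * m)]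
    push_cast
    ring
  rw [hpow, div_mul_div_comm, mul_comm (m.factorial : ℝ)]
  gcongr

theorem bessel_term_nonneg {x ν : ℝ} (hx : 0 < x) (hν : 0 ≤ ν) (m : ℕ) :
    0 ≤ x ^ (2 * (m : ℝ) + ν) / ((m.factorial : ℝ) * Real.Gamma ((m : ℝ) + ν + 1)) := by
  have := Real.Gamma_pos_of_pos (show 0 < (m : ℝ) + ν + 1 by positivity)
  positivity

theorem summable_besselI_term {x ν : ℝ} (hx : 0 < x) (hν : 1 ≤ ν) :
    Summable fun m : ℕ => x ^ (2 * (m : ℝ) + ν) /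
      ((m.factorial : ℝ) * Real.Gamma ((m : ℝ) + ν + 1)) :=
  Summable.of_nonneg_of_le (bessel_term_nonneg hx (by linarith))
    (bessel_term_bound hx le_rfl (by simpa using hν))
    ((Real.summable_pow_div_factorial (x ^ 2)).mul_left _)

theorem besselI_nonneg {ν ρ : ℝ} (hρ : 0 < ρ) (hν : 0 ≤ ν) : 0 ≤ besselI ν ρ :=
  tsum_nonneg (bessel_term_nonneg (half_pos hρ) hν)

theorem besselI_le {ν ρ : ℝ} {k : ℕ} (hρ : 0 < ρ) (hk : 1 ≤ k) (hν : (k : ℝ) ≤ ν) :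
    besselI ν ρ ≤ (ρ / 2) ^ ν / (k.factorial : ℝ) * Real.exp ((ρ / 2) ^ 2) := by
  have hk' : (1 : ℝ) ≤ k := by exact_mod_cast hk
  have hexp : Real.exp ((ρ / 2) ^ 2) = ∑' m : ℕ, ((ρ / 2) ^ 2) ^ m / (m.factorial : ℝ) := by
    rw [Real.exp_eq_exp_ℝ, NormedSpace.exp_eq_tsum_div]
  rw [hexp, ← tsum_mul_left]
  exact (summable_besselI_term (half_pos hρ) (hk'.trans hν)).tsum_le_tsum
    (bessel_term_bound (half_pos hρ) hk hν)
    ((Real.summable_pow_div_factorial _).mul_left _)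

theorem abs_besselJ_le_besselI {ν ρ : ℝ} (hρ : 0 < ρ) (hν : 1 ≤ ν) :
    |besselJ ν ρ| ≤ besselI ν ρ := by
  rw [← Real.norm_eq_abs]
  refine tsum_of_norm_bounded (summable_besselI_term (half_pos hρ) hν).hasSum fun m => ?_
  rw [mul_div_assoc, norm_mul, norm_pow, norm_neg, norm_one, one_pow, one_mul,
    Real.norm_of_nonneg (bessel_term_nonneg (half_pos hρ) (by linarith) m)]

theorem le_betaCoef {a : ℝ} (ha : 0 ≤ a) (k : ℕ) : (k : ℝ) + 1 / 2 ≤ betaCoef a k :=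
  Real.le_sqrt_of_sq_le (by linarith)

theorem betaCoef_le {a : ℝ} (ha : 0 ≤ a) (k : ℕ) :
    betaCoef a k ≤ (k : ℝ) + (1 / 2 + Real.sqrt a) := by
  refine Real.sqrt_le_iff.2 ⟨by positivity, ?_⟩
  have h : 0 ≤ ((k : ℝ) + 1 / 2) * Real.sqrt a := by positivity
  nlinarith [Real.sq_sqrt ha]

theorem besselI_betaCoef_le {a ρ : ℝ} (ha : 0 ≤ a) (hρ : 0 < ρ) {k : ℕ} (hk : 1 ≤ k) :
    (2 * (k : ℝ) + 1) * besselI (betaCoef a k) ρ ≤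
      2 * max 1 (ρ / 2) ^ (1 / 2 + Real.sqrt a) * Real.exp ((ρ / 2) ^ 2) *
        ((2 * max 1 (ρ / 2)) ^ k / (k.factorial : ℝ)) := by
  have hβ := le_betaCoef ha k
  have hX : 1 ≤ max 1 (ρ / 2) := le_max_left _ _
  have hX0 : 0 < max 1 (ρ / 2) := zero_lt_one.trans_le hX
  have hpow : (ρ / 2) ^ betaCoef a k ≤
      max 1 (ρ / 2) ^ k * max 1 (ρ / 2) ^ (1 / 2 + Real.sqrt a) := by
    rw [← Real.rpow_natCast, ← Real.rpow_add hX0]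
    exact (Real.rpow_le_rpow (half_pos hρ).le (le_max_right _ _) (Real.sqrt_nonneg _)).trans
      (Real.rpow_le_rpow_of_exponent_le hX (betaCoef_le ha k))
  have htwo : 2 * (k : ℝ) + 1 ≤ 2 * 2 ^ k := by
    have : (k : ℝ) + 1 ≤ 2 ^ k := by exact_mod_cast Nat.lt_two_pow_self (n := k)
    linarith
  calc (2 * (k : ℝ) + 1) * besselI (betaCoef a k) ρ
      ≤ (2 * 2 ^ k) * (max 1 (ρ / 2) ^ k * max 1 (ρ / 2) ^ (1 / 2 + Real.sqrt a) /
          (k.factorial : ℝ) * Real.exp ((ρ / 2) ^ 2)) := by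
        refine mul_le_mul htwo ?_ (besselI_nonneg hρ (Real.sqrt_nonneg _)) (by positivity)
        refine (besselI_le hρ hk (by linarith)).trans ?_
        gcongr
    _ = _ := by rw [mul_pow]; ring

theorem stmt1 (a : ℝ) (ha : 0 ≤ a) (ρ : ℝ) (hρ : 0 < ρ) :
    Summable (fun k : ℕ => (2 * (k : ℝ) + 1) * |besselJ (betaCoef a k) ρ|) ∧
    Summable (fun k : ℕ => (2 * (k : ℝ) + 1) * besselI (betaCoef a k) ρ) := by
  have hI : Summable (fun k : ℕ => (2 * (k : ℝ) + 1) * besselI (betaCoef a k) ρ) := by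
    refine Summable.of_norm_bounded_eventually_nat
      ((Real.summable_pow_div_factorial (2 * max 1 (ρ / 2))).mul_left
        (2 * max 1 (ρ / 2) ^ (1 / 2 + Real.sqrt a) * Real.exp ((ρ / 2) ^ 2))) ?_
    filter_upwards [Filter.eventually_ge_atTop 1] with k hk
    have hI0 : 0 ≤ besselI (betaCoef a k) ρ := besselI_nonneg hρ (Real.sqrt_nonneg _)
    rw [Real.norm_of_nonneg (by positivity)]
    exact besselI_betaCoef_le ha hρ hk
  refine ⟨Summable.of_norm_bounded_eventually_nat hI ?_, hI⟩
  filter_upwards [Filter.eventually_ge_atTop 1] with k hk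
  have hk' : (1 : ℝ) ≤ k := by exact_mod_cast hk
  have hβ := le_betaCoef ha k
  rw [Real.norm_of_nonneg (by positivity)]
  gcongr
  exact abs_besselJ_le_besselI hρ (by linarith)
end
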